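/- Let d ≥ 2, 1 ≤ k ≤ d, 2 ≤ r̃ ≤ r ≤ ∞, N ≥ 1, and set β(r,r̃) = (d−k)(1/2 − 1/r) + k(1/2 − 1/r̃). Let P_{≤N} denote frequency truncation to ℤ^d ∩ [−N,N]^d. Then for every t with 0 < |t| ≤ 1/(2N) and every f ∈ L^{r'}_x L^{r̃'}_y(𝕋^{d−k} × 𝕋^k), one has ‖e^{−itΔ} P_{≤N} f‖_{L^r_x L^{r̃}_y} ≤ C |t|^{−β(r,r̃)} ‖f‖_{L^{r'}_x L^{r̃'}_y}, with C independent of N, t, f. -/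

import Mathlib

open MeasureTheory Complex Finset
open scoped ENNReal Real ComplexConjugate

noncomputable section

/-- Mixed-norm building block: the `L^p` "norm" (`p ∈ [1,∞]`) of an
`ℝ≥0∞`-valued function, with the convention `essSup` for `p = ∞`. -/
def eNorm {α : Type*} [MeasurableSpace α] (p : ℝ≥0∞) (μ : Measure α) (g : α → ℝ≥0∞) : ℝ≥0∞ :=
  if p = ∞ then essSup g μ else (∫⁻ a, g a ^ p.toReal ∂μ) ^ (1 / p.toReal)

/-- The `m`-dimensional torus `𝕋^m = (ℝ/ℤ)^m`. -/
abbrev Torus (m : ℕ) := Fin m → AddCircle (1 : ℝ)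

/-- The character `z ↦ e^{2πi z·ξ}` on `𝕋^m`. -/
def eChar {m : ℕ} (ξ : Fin m → ℤ) (z : Torus m) : ℂ := ∏ i, fourier (ξ i) (z i)

/-- Fourier coefficient of a function on the product torus `𝕋^m × 𝕋^k`. -/
def fcoef {m k : ℕ} (f : Torus m × Torus k → ℂ) (ξ : (Fin m → ℤ) × (Fin k → ℤ)) : ℂ :=
  ∫ z : Torus m × Torus k, f z * conj (eChar ξ.1 z.1 * eChar ξ.2 z.2)

/-- The frequency box `ℤ^m ∩ [-N,N]^m`. -/
def box (m N : ℕ) : Finset (Fin m → ℤ) :=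
  Finset.Icc (fun _ => -(N : ℤ)) (fun _ => (N : ℤ))

/-- The mixed norm `‖f‖_{L^r_x L^s_y}` on `𝕋^m × 𝕋^k`, valued in `ℝ≥0∞`. -/
def mixedNorm {m k : ℕ} (r s : ℝ≥0∞) (f : Torus m × Torus k → ℂ) : ℝ≥0∞ :=
  eNorm r volume (fun x => eNorm s volume (fun y => (‖f (x, y)‖₊ : ℝ≥0∞)))

/-- The frequency-truncated Schrödinger propagator `e^{-itΔ}P_{≤N} f` on `𝕋^m × 𝕋^k`,
given on the Fourier side by multiplication with `e^{2πit|ξ|²} 𝟙_{[-N,N]^d}(ξ)`. -/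
def prp {m k : ℕ} (N : ℕ) (t : ℝ) (f : Torus m × Torus k → ℂ)
    (z : Torus m × Torus k) : ℂ :=
  ∑ ξ₁ ∈ box m N, ∑ ξ₂ ∈ box k N,
    fcoef f (ξ₁, ξ₂) *
      Complex.exp (2 * Real.pi * I * t * ((∑ i, (ξ₁ i : ℝ) ^ 2) + ∑ i, (ξ₂ i : ℝ) ^ 2)) *
      (eChar ξ₁ z.1 * eChar ξ₂ z.2)

/-! ### One-dimensional kernel bound -/

lemma lor_range (s : ℝ) (hs : 0 < s) (J : ℕ) :
    ∑ j ∈ range (J + 1), 1 / (1 + s ^ 2 * (j : ℝ) ^ 2) ≤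
      1 + (2 / s) * (1 - 1 / (1 + s * J)) := by
  induction J with
  | zero => simp
  | succ J ih =>
    rw [sum_range_succ]
    have hJ : (0 : ℝ) ≤ J := Nat.cast_nonneg J
    have h1 : 1 / (1 + s ^ 2 * ((J + 1 : ℕ) : ℝ) ^ 2) ≤
        (2 / s) * (1 / (1 + s * J) - 1 / (1 + s * (J + 1 : ℕ))) := by
      push_cast
      have hA : 0 < 1 + s * J := by positivity
      have hB : 0 < 1 + s * ((J : ℝ) + 1) := by positivity
      have e : (2 / s) * (1 / (1 + s * J) - 1 / (1 + s * ((J : ℝ) + 1))) =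
          2 / ((1 + s * J) * (1 + s * ((J : ℝ) + 1))) := by
        field_simp
        ring
      rw [e, div_le_div_iff₀ (by positivity) (by positivity)]
      nlinarith [sq_nonneg (1 - s * ((J : ℝ) + 1)), mul_pos hs hB]
    calc _ ≤ _ := add_le_add ih h1
      _ = _ := by ring

lemma lor_nat (s : ℝ) (hs : 0 < s) (A : Finset ℕ) :
    ∑ j ∈ A, 1 / (1 + s ^ 2 * (j : ℝ) ^ 2) ≤ 1 + 2 / s := by
  obtain ⟨J, hJ⟩ := A.exists_nat_subset_range
  calc _ ≤ ∑ j ∈ range (J + 1), 1 / (1 + s ^ 2 * (j : ℝ) ^ 2) := by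
        apply sum_le_sum_of_subset_of_nonneg
        · exact hJ.trans (range_subset_range.2 (Nat.le_succ J))
        · intros; positivity
    _ ≤ _ := lor_range s hs J
    _ ≤ _ := by
        have : 0 ≤ (2 / s) * (1 / (1 + s * J)) := by positivity
        linarith

lemma lor_int_half (s : ℝ) (hs : 0 < s) (c : ℝ) (S : Finset ℤ) (f : ℤ → ℕ)
    (hf : Set.InjOn f S) (h : ∀ n ∈ S, (f n : ℝ) ^ 2 ≤ ((n : ℝ) - c) ^ 2) :
    ∑ n ∈ S, 1 / (1 + s ^ 2 * ((n : ℝ) - c) ^ 2) ≤ 1 + 2 / s := by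
  calc _ ≤ ∑ n ∈ S, 1 / (1 + s ^ 2 * (f n : ℝ) ^ 2) := by
        apply sum_le_sum
        intro n hn
        have := h n hn
        gcongr
    _ = ∑ j ∈ S.image f, 1 / (1 + s ^ 2 * (j : ℝ) ^ 2) := 
        (sum_image (f := fun j : ℕ => 1 / (1 + s ^ 2 * (j : ℝ) ^ 2)) hf).symm
    _ ≤ _ := lor_nat s hs _

lemma lor_int (s : ℝ) (hs : 0 < s) (c : ℝ) (S : Finset ℤ) :
    ∑ n ∈ S, 1 / (1 + s ^ 2 * ((n : ℝ) - c) ^ 2) ≤ 2 * (1 + 2 / s) := by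
  rw [← sum_filter_add_sum_filter_not S (fun n => n ≤ ⌊c⌋)]
  have h1 : ∑ n ∈ S with n ≤ ⌊c⌋, 1 / (1 + s ^ 2 * ((n : ℝ) - c) ^ 2) ≤ 1 + 2 / s := by
    apply lor_int_half s hs c _ (fun n => (⌊c⌋ - n).toNat)
    · intro a ha b hb hab
      simp at ha hb hab
      omega
    · intro n hn
      simp at hn
      have e : (((⌊c⌋ - n).toNat : ℕ) : ℝ) = ((⌊c⌋ : ℤ) : ℝ) - n := by
        have : (((⌊c⌋ - n).toNat : ℕ) : ℤ) = ⌊c⌋ - n := Int.toNat_of_nonneg (by omega)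
        exact_mod_cast this
      rw [e]
      have := Int.floor_le c
      have h2 : (n : ℝ) ≤ ⌊c⌋ := by exact_mod_cast hn.2
      nlinarith
  have h2 : ∑ n ∈ S with ¬ n ≤ ⌊c⌋, 1 / (1 + s ^ 2 * ((n : ℝ) - c) ^ 2) ≤ 1 + 2 / s := by
    apply lor_int_half s hs c _ (fun n => (n - ⌊c⌋ - 1).toNat)
    · intro a ha b hb hab
      simp at ha hb hab
      omega
    · intro n hn
      simp at hn
      have e : (((n - ⌊c⌋ - 1).toNat : ℕ) : ℝ) = n - ((⌊c⌋ : ℤ) : ℝ) - 1 := by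
        have : (((n - ⌊c⌋ - 1).toNat : ℕ) : ℤ) = n - ⌊c⌋ - 1 := Int.toNat_of_nonneg (by omega)
        exact_mod_cast this
      rw [e]
      have := Int.lt_floor_add_one c
      have h2 : (⌊c⌋ : ℝ) + 1 ≤ n := by exact_mod_cast hn.2
      nlinarith
  linarith

/-- `e(θ) = exp(2πiθ)` -/
def ee (θ : ℝ) : ℂ := Complex.exp (2 * π * I * θ)

lemma ee_add (a b : ℝ) : ee (a + b) = ee a * ee b := by
  simp only [ee, ← Complex.exp_add]; push_cast; ring_nf

lemma ee_norm (a : ℝ) : ‖ee a‖ = 1 := by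
  rw [ee, show (2 * π * I * a : ℂ) = ((2 * π * a : ℝ) : ℂ) * I by push_cast; ring]
  exact Complex.norm_exp_ofReal_mul_I _

lemma ee_int (n : ℤ) : ee n = 1 := by
  rw [ee, show (2 * π * I * ((n : ℝ) : ℂ) : ℂ) = n * (2 * π * I) by push_cast; ring]
  exact Complex.exp_int_mul_two_pi_mul_I n

lemma ee_sub_one_norm (a : ℝ) : ‖ee a - 1‖ = 2 * |Real.sin (π * a)| := by
  rw [ee, show (2 * π * I * a : ℂ) = I * ((2 * π * a : ℝ) : ℂ) by push_cast; ring,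
    Complex.norm_exp_I_mul_ofReal_sub_one]
  rw [norm_mul, Real.norm_eq_abs, Real.norm_eq_abs]
  norm_num
  ring_nf

lemma ee_lower (a : ℝ) : 4 * |a - round a| ≤ ‖ee a - 1‖ := by
  have e : ee a = ee (a - round a) := by
    conv_lhs => rw [show a = (a - round a) + (round a : ℤ) by ring, ee_add, ee_int, mul_one]
  rw [e, ee_sub_one_norm]
  have h := abs_sub_round a
  set u := a - round a
  have h2 := Real.mul_abs_le_abs_sin (x := π * u) (by
    rw [abs_mul, abs_of_pos Real.pi_pos]; nlinarith [Real.pi_pos])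
  rw [abs_mul, abs_of_pos Real.pi_pos] at h2
  have : 2 / π * (π * |u|) = 2 * |u| := by field_simp
  linarith

lemma ee_lip (a b : ℝ) : ‖ee a - ee b‖ ≤ 2 * π * |a - b| := by
  have e : ee a - ee b = ee b * (ee (a - b) - 1) := by
    rw [mul_sub, ← ee_add]; simp
  rw [e, norm_mul, ee_norm, one_mul, ee_sub_one_norm]
  have : |Real.sin (π * (a - b))| ≤ |π * (a - b)| := Real.abs_sin_le_abs
  rw [abs_mul, abs_of_pos Real.pi_pos] at this
  linarith

/-- regularised inverse -/
def rinv (τ : ℝ) (w : ℂ) : ℂ := conj w / ((‖w‖ ^ 2 + τ : ℝ) : ℂ)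

lemma rinv_norm (τ : ℝ) (hτ : 0 < τ) (w : ℂ) : ‖rinv τ w‖ ≤ 1 / (2 * √τ) := by
  have hD : 0 < ‖w‖ ^ 2 + τ := by positivity
  have hs : 0 < √τ := Real.sqrt_pos.2 hτ
  rw [rinv, norm_div, RCLike.norm_conj, Complex.norm_real, Real.norm_eq_abs, abs_of_pos hD,
    div_le_div_iff₀ hD (by positivity)]
  nlinarith [sq_nonneg (‖w‖ - √τ), Real.sq_sqrt hτ.le]

lemma rinv_mul (τ : ℝ) (hτ : 0 < τ) (w : ℂ) :
    rinv τ w * w = 1 - ((τ / (‖w‖ ^ 2 + τ) : ℝ) : ℂ) := by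
  have hD : 0 < ‖w‖ ^ 2 + τ := by positivity
  have hD' : ((‖w‖ ^ 2 + τ : ℝ) : ℂ) ≠ 0 := by exact_mod_cast hD.ne'
  rw [rinv, div_mul_eq_mul_div, Complex.conj_mul']
  push_cast at hD' ⊢
  field_simp
  ring

lemma rinv_lip (τ : ℝ) (hτ : 0 < τ) (w v : ℂ) :
    ‖rinv τ w - rinv τ v‖ ≤ ‖w - v‖ * (1 / (‖w‖ ^ 2 + τ) + 1 / (‖v‖ ^ 2 + τ)) := by
  have hD : 0 < ‖w‖ ^ 2 + τ := by positivity
  have hE : 0 < ‖v‖ ^ 2 + τ := by positivity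
  have hD' : ((‖w‖ ^ 2 + τ : ℝ) : ℂ) ≠ 0 := by exact_mod_cast hD.ne'
  have hE' : ((‖v‖ ^ 2 + τ : ℝ) : ℂ) ≠ 0 := by exact_mod_cast hE.ne'
  have e : rinv τ w - rinv τ v = (conj w * conj v * (v - w) + τ * conj (w - v)) /
      (((‖w‖ ^ 2 + τ : ℝ) : ℂ) * ((‖v‖ ^ 2 + τ : ℝ) : ℂ)) := by
    rw [rinv, rinv, div_sub_div _ _ hD' hE']
    congr 1
    push_cast
    rw [← Complex.conj_mul', ← Complex.conj_mul', map_sub]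
    ring
  rw [e, norm_div, norm_mul, Complex.norm_real, Complex.norm_real, Real.norm_eq_abs,
    Real.norm_eq_abs, abs_of_pos hD, abs_of_pos hE]
  have h1 : ‖conj w * conj v * (v - w) + τ * conj (w - v)‖ ≤ ‖w - v‖ * (‖w‖ * ‖v‖ + τ) := by
    refine (norm_add_le _ _).trans ?_
    rw [norm_mul, norm_mul, norm_mul, RCLike.norm_conj, RCLike.norm_conj, RCLike.norm_conj,
      norm_sub_rev v w, Complex.norm_real, Real.norm_eq_abs, abs_of_pos hτ]
    apply le_of_eq; ring
  have h2 : 1 / (‖w‖ ^ 2 + τ) + 1 / (‖v‖ ^ 2 + τ) =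
      (‖w‖ ^ 2 + ‖v‖ ^ 2 + 2 * τ) / ((‖w‖ ^ 2 + τ) * (‖v‖ ^ 2 + τ)) := by
    field_simp; ring
  rw [h2, ← mul_div_assoc]
  gcongr
  refine h1.trans ?_
  apply mul_le_mul_of_nonneg_left _ (norm_nonneg _)
  nlinarith [sq_nonneg (‖w‖ - ‖v‖), sq_nonneg (‖w‖ + ‖v‖)]

lemma sum_parts (g a : ℕ → ℂ) (J : ℕ) :
    ∑ j ∈ range J, g j * (a (j + 1) - a j) =
      g J * a J - g 0 * a 0 - ∑ j ∈ range J, (g (j + 1) - g j) * a (j + 1) := by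
  induction J with
  | zero => simp
  | succ J ih => rw [sum_range_succ, sum_range_succ, ih]; ring

/-- Abstract summation by parts bound. -/
lemma sum_bound (τ η L : ℝ) (hτ : 0 < τ) (hη : 0 ≤ η) (a w : ℕ → ℂ) (ha : ∀ j, ‖a j‖ = 1)
    (haw : ∀ j, a (j + 1) - a j = w j * a j) (hw : ∀ j, ‖w (j + 1) - w j‖ ≤ η * τ) (J : ℕ)
    (hL : ∑ j ∈ range (J + 1), τ / (‖w j‖ ^ 2 + τ) ≤ L) :
    ‖∑ j ∈ range J, a j‖ ≤ 1 / √τ + (2 * η + 1) * L := by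
  have hs : 0 < √τ := Real.sqrt_pos.2 hτ
  have hpos : ∀ j, 0 ≤ τ / (‖w j‖ ^ 2 + τ) := fun j => by positivity
  have hL1 : ∑ j ∈ range J, τ / (‖w j‖ ^ 2 + τ) ≤ L := by
    rw [sum_range_succ] at hL; linarith [hpos J]
  have hL2 : ∑ j ∈ range J, τ / (‖w (j + 1)‖ ^ 2 + τ) ≤ L := by
    rw [sum_range_succ'] at hL; linarith [hpos 0]
  have e : ∑ j ∈ range J, a j = ∑ j ∈ range J, rinv τ (w j) * (a (j + 1) - a j) +
      ∑ j ∈ range J, ((τ / (‖w j‖ ^ 2 + τ) : ℝ) : ℂ) * a j := by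
    rw [← sum_add_distrib]
    apply sum_congr rfl
    intro j _
    rw [haw, ← mul_assoc, rinv_mul τ hτ]; ring
  rw [e, sum_parts]
  have b1 : ‖rinv τ (w J) * a J‖ ≤ 1 / (2 * √τ) := by
    rw [norm_mul, ha, mul_one]; exact rinv_norm τ hτ _
  have b2 : ‖rinv τ (w 0) * a 0‖ ≤ 1 / (2 * √τ) := by
    rw [norm_mul, ha, mul_one]; exact rinv_norm τ hτ _
  have b3 : ‖∑ j ∈ range J, (rinv τ (w (j + 1)) - rinv τ (w j)) * a (j + 1)‖ ≤ η * (L + L) := by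
    calc _ ≤ ∑ j ∈ range J, η * (τ / (‖w (j + 1)‖ ^ 2 + τ) + τ / (‖w j‖ ^ 2 + τ)) := by
          apply norm_sum_le_of_le
          intro j _
          rw [norm_mul, ha, mul_one]
          refine (rinv_lip τ hτ _ _).trans ?_
          calc _ ≤ (η * τ) * (1 / (‖w (j + 1)‖ ^ 2 + τ) + 1 / (‖w j‖ ^ 2 + τ)) := by
                gcongr; exact hw j
            _ = _ := by ring
      _ = η * (∑ j ∈ range J, τ / (‖w (j + 1)‖ ^ 2 + τ) + ∑ j ∈ range J, τ / (‖w j‖ ^ 2 + τ)) := by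
          rw [← mul_sum, sum_add_distrib]
      _ ≤ _ := by gcongr
  have b4 : ‖∑ j ∈ range J, ((τ / (‖w j‖ ^ 2 + τ) : ℝ) : ℂ) * a j‖ ≤ L := by
    refine le_trans (norm_sum_le_of_le _ ?_) hL1
    intro j _
    rw [norm_mul, ha, mul_one, Complex.norm_real, Real.norm_eq_abs, abs_of_nonneg (hpos j)]
  have hh : 1 / √τ = 1 / (2 * √τ) + 1 / (2 * √τ) := by field_simp; norm_num
  refine (norm_add_le _ _).trans ?_
  have := norm_sub_le (rinv τ (w J) * a J - rinv τ (w 0) * a 0)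
    (∑ j ∈ range J, (rinv τ (w (j + 1)) - rinv τ (w j)) * a (j + 1))
  have := norm_sub_le (rinv τ (w J) * a J) (rinv τ (w 0) * a 0)
  linarith

lemma kernel_real (N : ℕ) (hN : 1 ≤ N) (t : ℝ) (ht : t ≠ 0) (htN : |t| ≤ 1 / (2 * N)) (x : ℝ) :
    ‖∑ n ∈ Finset.Icc (-(N : ℤ)) N, ee (t * (n : ℝ) ^ 2 + n * x)‖ ≤ 500 / √|t| := by
  set τ := |t| with hτdef
  have hτ : 0 < τ := abs_pos.2 ht
  have hs : 0 < √τ := Real.sqrt_pos.2 hτ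
  have hN' : (1 : ℝ) ≤ N := by exact_mod_cast hN
  have hτN : τ * N ≤ 1 / 2 := by
    calc τ * N ≤ 1 / (2 * N) * N := by gcongr
      _ = 1 / 2 := by field_simp
  have hτ1 : τ ≤ 1 / 2 := by nlinarith
  have hs1 : √τ ≤ 1 := by rw [Real.sqrt_le_left (by norm_num)]; linarith
  let nn : ℕ → ℝ := fun j => (j : ℝ) - N
  let a : ℕ → ℂ := fun j => ee (t * (nn j) ^ 2 + nn j * x)
  let θ : ℕ → ℝ := fun j => t * (2 * nn j + 1) + x
  let w : ℕ → ℂ := fun j => ee (θ j) - 1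
  have e : ∑ n ∈ Finset.Icc (-(N : ℤ)) N, ee (t * (n : ℝ) ^ 2 + n * x) =
      ∑ j ∈ range (2 * N + 1), a j := by
    symm
    apply sum_bij (fun (j : ℕ) _ => (j : ℤ) - N)
    · intro j hj; simp at hj ⊢; omega
    · intro i _ j _ h; simpa using h
    · intro n hn
      simp at hn
      exact ⟨(n + N).toNat, by simp; omega, by omega⟩
    · intro j _; simp [a, nn]
  rw [e]
  have key : ∑ j ∈ range (2 * N + 1 + 1), τ / (‖w j‖ ^ 2 + τ) ≤ 14 * (1 + 1 / (4 * √τ)) := by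
    have p1 : ∀ j ∈ range (2 * N + 1 + 1), τ / (‖w j‖ ^ 2 + τ) ≤
        ∑ m ∈ Finset.Icc (round x - 3) (round x + 3),
          1 / (1 + (8 * √τ) ^ 2 * ((((j : ℤ) - N : ℤ) : ℝ) - (m - x - t) / (2 * t)) ^ 2) := by
      intro j hj
      have hj' : (j : ℝ) ≤ 2 * N + 1 := by
        have : j ≤ 2 * N + 1 := by simp at hj; omega
        exact_mod_cast this
      have hj0 : (0 : ℝ) ≤ j := Nat.cast_nonneg j
      have hclose : |θ j - x| ≤ 5 / 2 := by
        have : |2 * nn j + 1| ≤ 2 * N + 3 := by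
          rw [abs_le]; constructor <;> simp only [nn] <;> linarith
        simp only [θ, add_sub_cancel_right, abs_mul]
        calc τ * |2 * nn j + 1| ≤ τ * (2 * N + 3) := by gcongr
          _ ≤ _ := by nlinarith
      have hm : round (θ j) ∈ Finset.Icc (round x - 3) (round x + 3) := by
        have h1 := abs_le.1 (abs_sub_round (θ j))
        have h2 := abs_le.1 (abs_sub_round x)
        have h3 := abs_le.1 hclose
        have h4 : ((round (θ j) : ℤ) : ℝ) < ((round x + 4 : ℤ) : ℝ) := by push_cast; linarith
        have h5 : ((round x - 4 : ℤ) : ℝ) < ((round (θ j) : ℤ) : ℝ) := by push_cast; linarith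
        have h4' := Int.cast_lt.1 h4
        have h5' := Int.cast_lt.1 h5
        simp; omega
      refine le_trans ?_ (single_le_sum (f := fun m : ℤ => 1 / (1 + (8 * √τ) ^ 2 *
        ((((j : ℤ) - N : ℤ) : ℝ) - (m - x - t) / (2 * t)) ^ 2)) (fun m _ => by positivity) hm)
      have hl := ee_lower (θ j)
      have hsq : 16 * (θ j - round (θ j)) ^ 2 ≤ ‖w j‖ ^ 2 := by
        calc _ = (4 * |θ j - round (θ j)|) ^ 2 := by rw [mul_pow, sq_abs]; ring
          _ ≤ _ := by gcongr
      have heq : (8 * √τ) ^ 2 * ((((j : ℤ) - N : ℤ) : ℝ) - (round (θ j) - x - t) / (2 * t)) ^ 2 =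
          16 * (θ j - round (θ j)) ^ 2 / τ := by
        have hj2 : (((j : ℤ) - N : ℤ) : ℝ) - (round (θ j) - x - t) / (2 * t) =
            (θ j - round (θ j)) / (2 * t) := by
          simp only [θ, nn]
          push_cast
          field_simp
          ring
        rw [hj2, mul_pow, Real.sq_sqrt hτ.le, div_pow, mul_pow, ← sq_abs t, ← hτdef]
        field_simp
        ring
      simp only [heq]
      have e2 : (1 : ℝ) / (1 + 16 * (θ j - round (θ j)) ^ 2 / τ) =
          τ / (16 * (θ j - round (θ j)) ^ 2 + τ) := by
        field_simp
        ring
      rw [e2]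
      gcongr
    refine (sum_le_sum p1).trans ?_
    rw [sum_comm]
    calc _ ≤ ∑ m ∈ Finset.Icc (round x - 3) (round x + 3), 2 * (1 + 2 / (8 * √τ)) := by
          apply sum_le_sum
          intro m _
          have := lor_int (8 * √τ) (by positivity) ((m - x - t) / (2 * t))
            ((range (2 * N + 1 + 1)).image (fun j : ℕ => (j : ℤ) - N))
          rwa [sum_image (by intro i _ j _ h; simpa using h)] at this
      _ = _ := by
          rw [sum_const, Int.card_Icc]
          have : (round x + 3 + 1 - (round x - 3)).toNat = 7 := by omega
          rw [this, show 2 / (8 * √τ) = 1 / (4 * √τ) by field_simp; norm_num]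
          simp only [nsmul_eq_mul]
          push_cast
          ring
  have main := sum_bound τ (4 * π) _ hτ (by positivity) a w (fun j => ee_norm _) (by
    intro j
    simp only [w, sub_mul, one_mul]
    congr 1
    simp only [a, ← ee_add]
    congr 1
    simp only [θ, nn]; push_cast; ring) (by
    intro j
    simp only [w, sub_sub_sub_cancel_right]
    refine (ee_lip _ _).trans ?_
    have : θ (j + 1) - θ j = 2 * t := by simp only [θ, nn]; push_cast; ring
    rw [this, abs_mul, abs_two]
    apply le_of_eq; ring) (2 * N + 1) key
  refine main.trans ?_
  have hpi := Real.pi_lt_d2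
  have h1 : (1 : ℝ) ≤ 1 / √τ := by rw [le_div_iff₀ hs]; linarith
  have h2 : 1 / (4 * √τ) = (1 / √τ) / 4 := by field_simp
  have h3 : 500 / √τ = 500 * (1 / √τ) := by ring
  rw [h2, h3]
  set z := 1 / √τ
  have : (2 * (4 * π) + 1) * (14 * (1 + z / 4)) ≤ 27 * (14 * (1 + z / 4)) := by
    gcongr; linarith
  linarith

/-! ### A Marcinkiewicz type interpolation lemma -/

lemma lint_rpow (c κ Λ : ℝ) (hc : 0 ≤ c) (hκ : 0 < κ) (hΛ : 0 ≤ Λ) :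
    ∫⁻ l in Set.Ioc 0 Λ, ENNReal.ofReal (c * l ^ (κ - 1)) = ENNReal.ofReal (c * (Λ ^ κ / κ)) := by
  have hi : IntervalIntegrable (fun l : ℝ => l ^ (κ - 1)) volume 0 Λ :=
    intervalIntegral.intervalIntegrable_rpow' (by linarith)
  rw [intervalIntegrable_iff_integrableOn_Ioc_of_le hΛ] at hi
  rw [← ofReal_integral_eq_lintegral_ofReal (hi.const_mul c)]
  · rw [integral_const_mul, ← intervalIntegral.integral_of_le hΛ, integral_rpow (Or.inl (by linarith))]
    simp [Real.zero_rpow hκ.ne']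
  · filter_upwards [ae_restrict_mem measurableSet_Ioc] with l hl
    have : 0 ≤ l := hl.1.le
    positivity

lemma marcin_inner (c κ B r p : ℝ) (hc : 0 ≤ c) (hB : 0 < B) (hp : 2 ≤ p) (hpr : p < r)
    (hκ : κ = (r - p) / (p - 1)) (v : ℝ≥0∞) (hcB : 0 < c) :
    ∫⁻ l in Set.Ioi (0 : ℝ), ENNReal.ofReal (c * l ^ (κ - 1)) *
        {l : ℝ | v ≤ ENNReal.ofReal ((B / l) ^ (r - 1))}.indicator (fun _ => v ^ (p / (p - 1))) l ≤
      ENNReal.ofReal (c * (B ^ κ / κ)) * v ^ (r / (r - 1)) := by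
  have hp1 : 0 < p - 1 := by linarith
  have hr1 : 0 < r - 1 := by linarith
  have hκ0 : 0 < κ := by rw [hκ]; exact div_pos (by linarith) hp1
  have hpp : 0 < p / (p - 1) := div_pos (by linarith) hp1
  have hrr : 0 < r / (r - 1) := div_pos (by linarith) hr1
  rcases eq_or_ne v ∞ with rfl | hv
  · rw [ENNReal.top_rpow_of_pos hrr, ENNReal.mul_top]
    · exact le_top
    · rw [Ne, ENNReal.ofReal_eq_zero, not_le]; positivity
  rcases eq_or_ne v 0 with rfl | hv0
  · simp [ENNReal.zero_rpow_of_pos hpp]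
  obtain ⟨u, hu, rfl⟩ : ∃ u : ℝ, 0 < u ∧ v = ENNReal.ofReal u :=
    ⟨v.toReal, ENNReal.toReal_pos hv0 hv, (ENNReal.ofReal_toReal hv).symm⟩
  set Λ := B * u ^ (-(1 / (r - 1))) with hΛ
  have hΛ0 : 0 < Λ := by positivity
  calc _ ≤ ∫⁻ l in Set.Ioi (0 : ℝ), (Set.Ioc 0 Λ).indicator (fun l =>
          ENNReal.ofReal (c * l ^ (κ - 1)) * ENNReal.ofReal u ^ (p / (p - 1))) l := by
        apply setLIntegral_mono' measurableSet_Ioi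
        intro l hl
        have hl : 0 < l := hl
        by_cases h : ENNReal.ofReal u ≤ ENNReal.ofReal ((B / l) ^ (r - 1))
        · have h' : u ≤ (B / l) ^ (r - 1) := (ENNReal.ofReal_le_ofReal_iff (by positivity)).1 h
          have : l ≤ Λ := by
            have h2 : u ^ (1 / (r - 1)) ≤ B / l := by
              calc u ^ (1 / (r - 1)) ≤ ((B / l) ^ (r - 1)) ^ (1 / (r - 1)) := by gcongr
                _ = B / l := by
                  rw [← Real.rpow_mul (by positivity), mul_one_div_cancel hr1.ne', Real.rpow_one]
            rw [le_div_iff₀ hl] at h2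
            rw [hΛ, Real.rpow_neg hu.le, ← div_eq_mul_inv, le_div_iff₀ (by positivity)]
            linarith
          rw [Set.indicator_of_mem (show l ∈ Set.Ioc 0 Λ from ⟨hl, this⟩)]
          gcongr
          exact Set.indicator_le_self' (by simp) l
        · rw [Set.indicator_of_notMem (by exact h)]
          simp
    _ = ∫⁻ l in Set.Ioc 0 Λ, ENNReal.ofReal (c * l ^ (κ - 1)) * ENNReal.ofReal u ^ (p / (p - 1)) := by
        rw [lintegral_indicator measurableSet_Ioc, Measure.restrict_restrict measurableSet_Ioc]
        congr 2
        ext l; simp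
    _ = ENNReal.ofReal (c * (Λ ^ κ / κ)) * ENNReal.ofReal u ^ (p / (p - 1)) := by
        rw [lintegral_mul_const _ (by fun_prop), lint_rpow c κ Λ hc hκ0 hΛ0.le]
    _ = _ := by
        rw [ENNReal.ofReal_rpow_of_pos hu, ENNReal.ofReal_rpow_of_pos hu,
          ← ENNReal.ofReal_mul (by positivity), ← ENNReal.ofReal_mul (by positivity)]
        congr 1
        rw [hΛ, Real.mul_rpow hB.le (by positivity), ← Real.rpow_mul hu.le]
        have : u ^ (r / (r - 1)) = u ^ (-(1 / (r - 1)) * κ) * u ^ (p / (p - 1)) := by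
          rw [← Real.rpow_add hu]
          congr 1
          rw [hκ]; field_simp; ring
        rw [this]; ring
    _ ≤ _ := le_rfl

theorem marcin {α : Type*} [MeasurableSpace α] (μ : Measure α) [SFinite μ] {p r M0 M1 : ℝ}
    (hp : 2 ≤ p) (hpr : p < r) (hM0 : 0 < M0) (hM1 : 0 < M1) (φ G : α → ℝ≥0∞)
    (hφ : Measurable φ) (hG : Measurable G) (hGtop : ∀ x, G x ≠ ∞)
    (h : ∀ a : ℝ, 0 < a → ∃ G0 : α → ℝ≥0∞, Measurable G0 ∧
      (∀ᵐ x ∂μ, G x ≤ G0 x +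
        ENNReal.ofReal M1 * ∫⁻ x in {x | ENNReal.ofReal a < φ x}, φ x ∂μ) ∧
      ∫⁻ x, G0 x ^ p ∂μ ≤ ENNReal.ofReal (M0 ^ p) *
        (∫⁻ x in {x | φ x ≤ ENNReal.ofReal a}, φ x ^ (p / (p - 1)) ∂μ) ^ (p - 1)) :
    ∫⁻ x, G x ^ r ∂μ ≤ ENNReal.ofReal (r * 2 ^ r / ((r - p) / (p - 1)) * M0 ^ p * M1 ^ (r - p)) *
      (∫⁻ x, φ x ^ (r / (r - 1)) ∂μ) ^ (r - 1) := by
  have hp1 : 0 < p - 1 := by linarith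
  have hr1 : 0 < r - 1 := by linarith
  have hr0 : 0 < r := by linarith
  have hrp : 0 < r - p := by linarith
  set κ := (r - p) / (p - 1) with hκ
  have hκ0 : 0 < κ := div_pos (by linarith) hp1
  have hpp : 0 < p / (p - 1) := div_pos (by linarith) hp1
  have hrr : 0 < r / (r - 1) := div_pos (by linarith) hr1
  set E := ∫⁻ x, φ x ^ (r / (r - 1)) ∂μ with hE
  rcases eq_or_ne E ∞ with hEt | hEt
  · rw [hEt, ENNReal.top_rpow_of_pos hr1, ENNReal.mul_top]
    · exact le_top
    · rw [Ne, ENNReal.ofReal_eq_zero, not_le]; positivity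
  rcases eq_or_ne E 0 with hE0 | hE0
  · have hφ0 : φ =ᵐ[μ] 0 := by
      have := (lintegral_eq_zero_iff (hφ.pow_const _)).1 hE0
      filter_upwards [this] with x hx
      simpa [ENNReal.rpow_eq_zero_iff, hrr, hrr.not_gt] using hx
    obtain ⟨G0, hG0m, hG0, hG0i⟩ := h 1 one_pos
    have z1 : ∫⁻ x in {x | ENNReal.ofReal 1 < φ x}, φ x ∂μ = 0 := by
      rw [lintegral_eq_zero_iff hφ]
      exact ae_restrict_of_ae hφ0
    have z2 : ∫⁻ x in {x | φ x ≤ ENNReal.ofReal 1}, φ x ^ (p / (p - 1)) ∂μ = 0 := by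
      rw [lintegral_eq_zero_iff (hφ.pow_const _)]
      apply ae_restrict_of_ae
      filter_upwards [hφ0] with x hx
      simp only [Pi.zero_apply] at hx ⊢
      rw [hx, ENNReal.zero_rpow_of_pos hpp]
    rw [z2, ENNReal.zero_rpow_of_pos hp1, mul_zero, nonpos_iff_eq_zero,
      lintegral_eq_zero_iff (hG0m.pow_const _)] at hG0i
    rw [z1, mul_zero] at hG0
    have : ∫⁻ x, G x ^ r ∂μ = 0 := by
      rw [lintegral_eq_zero_iff (hG.pow_const _)]
      filter_upwards [hG0i, hG0] with x h1 h2
      have h3 : G0 x = 0 := by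
        simpa [ENNReal.rpow_eq_zero_iff, show 0 < p by linarith, show ¬ p < 0 by linarith] using h1
      rw [h3, zero_add, nonpos_iff_eq_zero] at h2
      simp [h2, hr0]
    rw [this]; exact zero_le
  obtain ⟨e, he, hee⟩ : ∃ e : ℝ, 0 < e ∧ E = ENNReal.ofReal e :=
    ⟨E.toReal, ENNReal.toReal_pos hE0 hEt, (ENNReal.ofReal_toReal hEt).symm⟩
  set B := 2 * M1 * e with hB
  have hB0 : 0 < B := by positivity
  set c := (2 * M0) ^ p * (B ^ κ * e) ^ (p - 2) with hc
  have hc0 : 0 < c := by positivity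
  clear_value c B
  -- the level set estimate
  have level : ∀ l : ℝ, 0 < l → μ {x | l < (G x).toReal} * ENNReal.ofReal (l ^ (r - 1)) ≤
      ENNReal.ofReal (c * l ^ (κ - 1)) *
      ∫⁻ x, {x | φ x ≤ ENNReal.ofReal ((B / l) ^ (r - 1))}.indicator
        (fun x => φ x ^ (p / (p - 1))) x ∂μ := by
    intro l hl
    set a := (B / l) ^ (r - 1) with ha
    have ha0 : 0 < a := by positivity
    obtain ⟨G0, hG0m, hG0, hG0i⟩ := h a ha0
    set H := ∫⁻ x in {x | φ x ≤ ENNReal.ofReal a}, φ x ^ (p / (p - 1)) ∂μ with hH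
    rw [lintegral_indicator (measurableSet_le hφ measurable_const), ← hH]
    have hHle : H ≤ ENNReal.ofReal ((B / l) ^ κ * e) := by
      have e1 : (B / l) ^ κ = a ^ (p / (p - 1) - r / (r - 1)) := by
        rw [ha, ← Real.rpow_mul (by positivity)]
        congr 1
        rw [hκ]; field_simp; ring
      have hdiff : 0 ≤ p / (p - 1) - r / (r - 1) := by
        rw [sub_nonneg, div_le_div_iff₀ hr1 hp1]; nlinarith
      rw [e1, ENNReal.ofReal_mul (by positivity), ← hee, hE, ← lintegral_const_mul _ (hφ.pow_const _)]
      refine le_trans (setLIntegral_mono' (measurableSet_le hφ measurable_const) ?_)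
        (setLIntegral_le_lintegral _ _)
      intro x hx
      have hx : φ x ≤ ENNReal.ofReal a := hx
      calc φ x ^ (p / (p - 1)) = φ x ^ (p / (p - 1) - r / (r - 1)) * φ x ^ (r / (r - 1)) := by
            rw [← ENNReal.rpow_add_of_nonneg _ _ hdiff hrr.le, sub_add_cancel]
        _ ≤ _ := by
            gcongr
            rw [← ENNReal.ofReal_rpow_of_pos ha0]
            gcongr
    have htail : ENNReal.ofReal M1 * ∫⁻ x in {x | ENNReal.ofReal a < φ x}, φ x ∂μ ≤
        ENNReal.ofReal (l / 2) := by
      have e1 : l / 2 = M1 * (a ^ (-(1 / (r - 1))) * e) := by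
        rw [ha, ← Real.rpow_mul (by positivity), show (r - 1) * -(1 / (r - 1)) = -1 by field_simp,
          Real.rpow_neg_one, hB]
        field_simp
      rw [e1, ENNReal.ofReal_mul hM1.le]
      gcongr
      rw [ENNReal.ofReal_mul (by positivity), ← hee, hE, ← lintegral_const_mul _ (hφ.pow_const _)]
      refine le_trans (setLIntegral_mono' (measurableSet_lt measurable_const hφ) ?_)
        (setLIntegral_le_lintegral _ _)
      intro x hx
      have hx : ENNReal.ofReal a < φ x := hx
      rcases eq_or_ne (φ x) ∞ with ht | ht
      · rw [ht, ENNReal.top_rpow_of_pos hrr, ENNReal.mul_top]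
        rw [Ne, ENNReal.ofReal_eq_zero, not_le]; positivity
      have hv0 : φ x ≠ 0 := (lt_of_le_of_lt zero_le hx).ne'
      obtain ⟨v, hv, hve⟩ : ∃ v : ℝ, 0 < v ∧ φ x = ENNReal.ofReal v :=
        ⟨_, ENNReal.toReal_pos hv0 ht, (ENNReal.ofReal_toReal ht).symm⟩
      rw [hve] at hx ⊢
      have hav : a < v := (ENNReal.ofReal_lt_ofReal_iff hv).1 hx
      rw [ENNReal.ofReal_rpow_of_pos hv, ← ENNReal.ofReal_mul (by positivity)]
      apply ENNReal.ofReal_le_ofReal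
      calc v = v ^ (-(1 / (r - 1))) * v ^ (r / (r - 1)) := by
            rw [← Real.rpow_add hv, show -(1 / (r - 1)) + r / (r - 1) = 1 by field_simp; ring,
              Real.rpow_one]
        _ ≤ _ := by
            have : v ^ (-(1 / (r - 1))) ≤ a ^ (-(1 / (r - 1))) :=
              Real.rpow_le_rpow_of_nonpos ha0 hav.le (by rw [neg_nonpos]; positivity)
            gcongr
    have hset : μ {x | l < (G x).toReal} ≤
        (∫⁻ x, G0 x ^ p ∂μ) / ENNReal.ofReal ((l / 2) ^ p) := by
      calc _ ≤ μ {x | ENNReal.ofReal ((l / 2) ^ p) ≤ G0 x ^ p} := by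
            apply measure_mono_ae
            filter_upwards [hG0] with x hx hlx
            have hlx : l < (G x).toReal := hlx
            have h1 : ENNReal.ofReal l < G x := (ENNReal.ofReal_lt_iff_lt_toReal hl.le (hGtop x)).2 hlx
            have h2 : ENNReal.ofReal l ≤ G0 x + ENNReal.ofReal (l / 2) :=
              h1.le.trans (hx.trans (by gcongr))
            have h3 : ENNReal.ofReal (l / 2) ≤ G0 x := by
              have : ENNReal.ofReal l = ENNReal.ofReal (l / 2) + ENNReal.ofReal (l / 2) := by
                rw [← ENNReal.ofReal_add (by positivity) (by positivity)]; congr 1; ring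
              rw [this] at h2
              exact (ENNReal.add_le_add_iff_right ENNReal.ofReal_ne_top).1 h2
            change ENNReal.ofReal ((l / 2) ^ p) ≤ G0 x ^ p
            rw [← ENNReal.ofReal_rpow_of_pos (by positivity)]
            gcongr
        _ ≤ _ := meas_ge_le_lintegral_div (hG0m.pow_const _).aemeasurable
            (by rw [Ne, ENNReal.ofReal_eq_zero, not_le]; positivity) ENNReal.ofReal_ne_top
    have hHp : H ^ (p - 1) ≤ H * ENNReal.ofReal (((B / l) ^ κ * e) ^ (p - 2)) := by
      calc H ^ (p - 1) = H ^ (1 : ℝ) * H ^ (p - 2) := by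
            rw [← ENNReal.rpow_add_of_nonneg _ _ (by norm_num) (by linarith)]; congr 1; ring
        _ ≤ _ := by
            rw [ENNReal.rpow_one, ← ENNReal.ofReal_rpow_of_pos (by positivity)]
            gcongr
    calc _ ≤ (∫⁻ x, G0 x ^ p ∂μ) / ENNReal.ofReal ((l / 2) ^ p) * ENNReal.ofReal (l ^ (r - 1)) := by
          gcongr
      _ ≤ (ENNReal.ofReal (M0 ^ p) * (H * ENNReal.ofReal (((B / l) ^ κ * e) ^ (p - 2)))) /
            ENNReal.ofReal ((l / 2) ^ p) * ENNReal.ofReal (l ^ (r - 1)) := by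
          gcongr
          exact hG0i.trans (by gcongr)
      _ = (ENNReal.ofReal (M0 ^ p) * ENNReal.ofReal (((B / l) ^ κ * e) ^ (p - 2)) *
            (ENNReal.ofReal ((l / 2) ^ p))⁻¹ * ENNReal.ofReal (l ^ (r - 1))) * H := by
          rw [div_eq_mul_inv]; ring
      _ = _ := by
          congr 1
          rw [← ENNReal.ofReal_inv_of_pos (by positivity), ← ENNReal.ofReal_mul (by positivity),
            ← ENNReal.ofReal_mul (by positivity), ← ENNReal.ofReal_mul (by positivity)]
          congr 1
          rw [hc, Real.div_rpow hB0.le hl.le, Real.div_rpow hl.le (by norm_num),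
            Real.mul_rpow (by norm_num) hM0.le, Real.mul_rpow (by positivity) he.le,
            Real.mul_rpow (by positivity) he.le, Real.div_rpow (by positivity) (by positivity),
            ← Real.rpow_mul hl.le κ]
          have : l ^ (r - 1) = l ^ (κ - 1) * l ^ p * l ^ (κ * (p - 2)) := by
            rw [← Real.rpow_add hl, ← Real.rpow_add hl]
            congr 1
            rw [hκ]; field_simp; ring
          rw [this]
          field_simp
  have lay : ∫⁻ x, G x ^ r ∂μ = ENNReal.ofReal r * ∫⁻ l in Set.Ioi 0,
      μ {x | l < (G x).toReal} * ENNReal.ofReal (l ^ (r - 1)) := by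
    rw [← lintegral_rpow_eq_lintegral_meas_lt_mul μ (Filter.Eventually.of_forall
      (fun x => ENNReal.toReal_nonneg)) hG.ennreal_toReal.aemeasurable hr0]
    apply lintegral_congr
    intro x
    rw [← ENNReal.ofReal_rpow_of_nonneg ENNReal.toReal_nonneg hr0.le, ENNReal.ofReal_toReal (hGtop x)]
  rw [lay]
  calc _ ≤ ENNReal.ofReal r * ∫⁻ l in Set.Ioi (0 : ℝ), ∫⁻ x, ENNReal.ofReal (c * l ^ (κ - 1)) *
        {x | φ x ≤ ENNReal.ofReal ((B / l) ^ (r - 1))}.indicator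
        (fun x => φ x ^ (p / (p - 1))) x ∂μ := by
        gcongr ENNReal.ofReal r * ?_
        apply setLIntegral_mono' measurableSet_Ioi
        intro l hl
        refine (level l hl).trans (le_of_eq ?_)
        rw [lintegral_const_mul]
        exact (hφ.pow_const _).indicator (measurableSet_le hφ measurable_const)
    _ = ENNReal.ofReal r * ∫⁻ x, (∫⁻ l in Set.Ioi (0 : ℝ), ENNReal.ofReal (c * l ^ (κ - 1)) *
        {l : ℝ | φ x ≤ ENNReal.ofReal ((B / l) ^ (r - 1))}.indicator
          (fun _ => φ x ^ (p / (p - 1))) l) ∂μ := by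
        rw [lintegral_lintegral_swap]
        · rfl
        · apply Measurable.aemeasurable
          apply Measurable.mul
          · fun_prop
          · have hs : MeasurableSet {q : ℝ × α | φ q.2 ≤ ENNReal.ofReal ((B / q.1) ^ (r - 1))} := by
              apply measurableSet_le
              · fun_prop
              · fun_prop
            have : Measurable ({q : ℝ × α | φ q.2 ≤ ENNReal.ofReal ((B / q.1) ^ (r - 1))}.indicator
                (fun q => φ q.2 ^ (p / (p - 1)))) := by
              apply Measurable.indicator _ hs
              fun_prop
            exact this
    _ ≤ ENNReal.ofReal r * ∫⁻ x, ENNReal.ofReal (c * (B ^ κ / κ)) * φ x ^ (r / (r - 1)) ∂μ := by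
        gcongr with x
        exact marcin_inner c κ B r p hc0.le hB0 hp hpr hκ (φ x) hc0
    _ = _ := by
        rw [lintegral_const_mul _ (hφ.pow_const _), ← hE, hee, ENNReal.ofReal_rpow_of_pos he,
          ← ENNReal.ofReal_mul (by positivity), ← ENNReal.ofReal_mul (by positivity),
          ← ENNReal.ofReal_mul (by positivity)]
        congr 1
        have k1 : B ^ (r - p) = (B ^ κ) ^ (p - 2) * B ^ κ := by
          rw [← Real.rpow_mul hB0.le, ← Real.rpow_add hB0]
          congr 1
          rw [hκ]; field_simp; ring
        have k2 : e ^ (r - 1) = e ^ (r - p) * e ^ (p - 2) * e := by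
          conv_rhs => rw [← Real.rpow_add he, ← Real.rpow_add_one he.ne']
          congr 1; ring
        have k3 : (2 : ℝ) ^ r = 2 ^ p * 2 ^ (r - p) := by
          rw [← Real.rpow_add (by norm_num)]; congr 1; ring
        have k4 : B ^ (r - p) = 2 ^ (r - p) * M1 ^ (r - p) * e ^ (r - p) := by
          rw [hB, Real.mul_rpow (by positivity) he.le, Real.mul_rpow (by norm_num) hM1.le]
        rw [hc, Real.mul_rpow (by norm_num) hM0.le, Real.mul_rpow (by positivity) he.le, k2, k3]
        have : r * ((2 : ℝ) ^ p * M0 ^ p * ((B ^ κ) ^ (p - 2) * e ^ (p - 2)) * (B ^ κ / κ) * e) =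
            r / κ * 2 ^ p * M0 ^ p * e ^ (p - 2) * e * ((B ^ κ) ^ (p - 2) * B ^ κ) := by ring
        rw [this, ← k1, k4]
        ring

/-! ### Integral operators -/

/-- Integral operator with kernel `K`. -/
def TK {α : Type*} [MeasurableSpace α] (μ : Measure α) (K : α → α → ℂ) (f : α → ℂ) (z : α) : ℂ :=
  ∫ w, K z w * f w ∂μ

/-- Good kernels: measurable, bounded by `A`, contractive on `L²`. -/
structure GoodKer {α : Type*} [MeasurableSpace α] (μ : Measure α) (A : ℝ) (K : α → α → ℂ) :
    Prop where
  pos : 0 < A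
  meas : Measurable (Function.uncurry K)
  bdd : ∀ z w, ‖K z w‖ ≤ A
  l2 : ∀ f : α → ℂ, Measurable f → Integrable f μ →
    ∫⁻ z, ‖TK μ K f z‖ₑ ^ (2 : ℝ) ∂μ ≤ ∫⁻ z, ‖f z‖ₑ ^ (2 : ℝ) ∂μ

section ops
variable {α : Type*} [MeasurableSpace α] {μ : Measure α} {A : ℝ} {K : α → α → ℂ}

lemma GoodKer.integrable (h : GoodKer μ A K) {f : α → ℂ} (hf : Integrable f μ) (z : α) :
    Integrable (fun w => K z w * f w) μ := by
  apply hf.bdd_mul (c := A)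
  · exact (h.meas.comp (measurable_prodMk_left)).aestronglyMeasurable
  · exact Filter.Eventually.of_forall (h.bdd z)

lemma GoodKer.enorm_le (h : GoodKer μ A K) (z w : α) : ‖K z w‖ₑ ≤ ENNReal.ofReal A := by
  rw [← ofReal_norm]
  exact ENNReal.ofReal_le_ofReal (h.bdd z w)

lemma GoodKer.sup (h : GoodKer μ A K) (f : α → ℂ) (hf : Measurable f) (z : α) :
    ‖TK μ K f z‖ₑ ≤ ENNReal.ofReal A * ∫⁻ w, ‖f w‖ₑ ∂μ := by
  calc _ ≤ ∫⁻ w, ‖K z w * f w‖ₑ ∂μ := enorm_integral_le_lintegral_enorm _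
    _ ≤ ∫⁻ w, ENNReal.ofReal A * ‖f w‖ₑ ∂μ := by
        gcongr with w
        rw [enorm_mul]
        gcongr
        exact h.enorm_le z w
    _ = _ := lintegral_const_mul _ hf.enorm

lemma GoodKer.measT [SFinite μ] (h : GoodKer μ A K) (f : α → ℂ) (hf : Measurable f) :
    Measurable (TK μ K f) := by
  apply StronglyMeasurable.measurable
  apply MeasureTheory.StronglyMeasurable.integral_prod_right (f := fun z w => K z w * f w)
  exact (h.meas.mul (hf.comp measurable_snd)).stronglyMeasurable

lemma GoodKer.split (h : GoodKer μ A K) {f : α → ℂ} (hf : Integrable f μ)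
    {S : Set α} (hS : MeasurableSet S) (z : α) :
    TK μ K f z = TK μ K (S.indicator f) z + TK μ K (Sᶜ.indicator f) z := by
  unfold TK
  rw [← integral_add (h.integrable (hf.indicator hS) z) (h.integrable (hf.indicator hS.compl) z)]
  congr 1
  ext w
  rw [← mul_add]
  congr 1
  exact (congrFun (Set.indicator_self_add_compl S f) w).symm

/-- constant in the scalar bound -/
def Cs (s : ℝ) : ℝ := if s = 2 then 1 else s * 2 ^ s / ((s - 2) / (2 - 1))

lemma Cs_pos {s : ℝ} (hs : 2 ≤ s) : 0 < Cs s := by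
  unfold Cs
  split_ifs with h
  · norm_num
  · have : 0 < s - 2 := by
      rcases hs.lt_or_eq with h1 | h1
      · linarith
      · exact absurd h1.symm h
    have : 0 < s := by linarith
    norm_num
    positivity

theorem GoodKer.scalar [IsFiniteMeasure μ] (h : GoodKer μ A K) {s : ℝ} (hs : 2 ≤ s)
    (f : α → ℂ) (hf : Measurable f) (hfi : Integrable f μ) :
    ∫⁻ z, ‖TK μ K f z‖ₑ ^ s ∂μ ≤ ENNReal.ofReal (Cs s * A ^ (s - 2)) *
      (∫⁻ z, ‖f z‖ₑ ^ (s / (s - 1)) ∂μ) ^ (s - 1) := by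
  rcases hs.lt_or_eq with hs2 | rfl
  swap
  · have := h.l2 f hf hfi
    simp only [Cs, if_true, sub_self, Real.rpow_zero, mul_one, ENNReal.ofReal_one, one_mul]
    norm_num
    norm_num at this
    exact this
  · have hm := marcin μ (p := 2) (r := s) (M0 := 1) (M1 := A) le_rfl hs2 one_pos h.pos
      (fun z => ‖f z‖ₑ) (fun z => ‖TK μ K f z‖ₑ) hf.enorm (h.measT f hf).enorm
      (fun x => enorm_ne_top) (by
        intro a ha
        set S : Set α := {x | ‖f x‖ₑ ≤ ENNReal.ofReal a} with hS
        have hSm : MeasurableSet S := measurableSet_le hf.enorm measurable_const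
        have hSc : Sᶜ = {x | ENNReal.ofReal a < ‖f x‖ₑ} := by ext x; simp [hS]
        refine ⟨fun z => ‖TK μ K (S.indicator f) z‖ₑ, (h.measT _ (hf.indicator hSm)).enorm,
          Filter.Eventually.of_forall fun z => ?_, ?_⟩
        · simp only
          rw [h.split hfi hSm z]
          refine (enorm_add_le _ _).trans ?_
          gcongr
          refine (h.sup _ (hf.indicator hSm.compl) z).trans ?_
          rw [← hSc, ← lintegral_indicator hSm.compl]
          gcongr with w
          rw [enorm_indicator_eq_indicator_enorm]
        · refine (h.l2 _ (hf.indicator hSm) (hfi.indicator hSm)).trans ?_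
          norm_num
          rw [← lintegral_indicator hSm]
          apply lintegral_mono
          intro w
          by_cases hw : w ∈ S <;> simp [hw])
    rw [Real.one_rpow, mul_one] at hm
    rw [Cs, if_neg hs2.ne']
    exact hm

end ops

theorem minkowski_int {α β : Type*} [MeasurableSpace α] [MeasurableSpace β] (μ : Measure α)
    (ν : Measure β) [SFinite μ] [SFinite ν] (F : α → β → ℝ≥0∞)
    (hF : Measurable (Function.uncurry F)) {s : ℝ} (hs : 1 < s)
    (hfin : ∫⁻ y, (∫⁻ x, F x y ∂μ) ^ s ∂ν ≠ ∞) :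
    (∫⁻ y, (∫⁻ x, F x y ∂μ) ^ s ∂ν) ^ (1 / s) ≤ ∫⁻ x, (∫⁻ y, F x y ^ s ∂ν) ^ (1 / s) ∂μ := by
  set H : β → ℝ≥0∞ := fun y => ∫⁻ x, F x y ∂μ with hH
  have hHm : Measurable H := hF.lintegral_prod_left'
  set I := ∫⁻ y, H y ^ s ∂ν with hI
  have hs0 : 0 < s := by linarith
  have hc : s.HolderConjugate (s / (s - 1)) := Real.HolderConjugate.conjExponent hs
  have h1 : I = ∫⁻ x, ∫⁻ y, F x y * H y ^ (s - 1) ∂ν ∂μ := by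
    rw [lintegral_lintegral_swap]
    · rw [hI]
      apply lintegral_congr
      intro y
      rw [lintegral_mul_const]
      · change H y ^ s = H y * H y ^ (s - 1)
        conv_rhs => rw [← ENNReal.rpow_one (H y), ← ENNReal.rpow_mul, one_mul,
          ← ENNReal.rpow_add_of_nonneg _ _ (by norm_num) (by linarith)]
        congr 1; ring
      · exact hF.comp measurable_prodMk_right
    · exact (hF.mul ((hHm.comp measurable_snd).pow_const _)).aemeasurable
  have h2 : I ≤ (∫⁻ x, (∫⁻ y, F x y ^ s ∂ν) ^ (1 / s) ∂μ) * I ^ (1 / (s / (s - 1))) := by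
    conv_lhs => rw [h1]
    rw [← lintegral_mul_const]
    · apply lintegral_mono
      intro x
      have := ENNReal.lintegral_mul_le_Lp_mul_Lq ν hc (f := F x) (g := fun y => H y ^ (s - 1))
        (hF.comp measurable_prodMk_left).aemeasurable (hHm.pow_const _).aemeasurable
      have e : ∀ y, (H y ^ (s - 1)) ^ (s / (s - 1)) = H y ^ s := by
        intro y
        rw [← ENNReal.rpow_mul, mul_div_cancel₀ _ (by linarith : s - 1 ≠ 0)]
      simp only [e] at this
      exact this
    · exact ((hF.pow_const s).lintegral_prod_right').pow_const _
  rcases eq_or_ne I 0 with h0 | h0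
  · rw [h0, ENNReal.zero_rpow_of_pos (by positivity)]; exact zero_le
  have h3 : I = I ^ (1 / s) * I ^ (1 / (s / (s - 1))) := by
    rw [← ENNReal.rpow_add _ _ h0 hfin, show 1 / s + 1 / (s / (s - 1)) = 1 by field_simp; ring,
      ENNReal.rpow_one]
  have hne0 : I ^ (1 / (s / (s - 1))) ≠ 0 := by
    simp [ENNReal.rpow_eq_zero_iff, h0, hfin]
  have hnet : I ^ (1 / (s / (s - 1))) ≠ ∞ := by
    apply ENNReal.rpow_ne_top_of_nonneg _ hfin
    have : 0 < s - 1 := by linarith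
    positivity
  nth_rewrite 1 [h3] at h2
  exact (ENNReal.mul_le_mul_iff_left hne0 hnet).1 h2

/-! ### Product kernels and mixed norms -/

/-- tensor product kernel -/
def PK {α β : Type*} (K1 : α → α → ℂ) (K2 : β → β → ℂ) : α × β → α × β → ℂ :=
  fun z w => K1 z.1 w.1 * K2 z.2 w.2

section prod
variable {α β : Type*} [MeasurableSpace α] [MeasurableSpace β] {μ : Measure α} {ν : Measure β}
  [IsFiniteMeasure μ] [IsFiniteMeasure ν] {A1 A2 : ℝ} {K1 : α → α → ℂ} {K2 : β → β → ℂ}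

lemma TK_prod (h1 : GoodKer μ A1 K1) (h : GoodKer (μ.prod ν) (A1 * A2) (PK K1 K2))
    (f : α × β → ℂ) (hfi : Integrable f (μ.prod ν)) (x : α) (y : β) :
    ‖TK (μ.prod ν) (PK K1 K2) f (x, y)‖ₑ ≤
      ENNReal.ofReal A1 * ∫⁻ x', ‖TK ν K2 (fun y' => f (x', y')) y‖ₑ ∂μ := by
  have e : TK (μ.prod ν) (PK K1 K2) f (x, y) =
      ∫ x', K1 x x' * TK ν K2 (fun y' => f (x', y')) y ∂μ := by
    unfold TK
    rw [integral_prod _ (h.integrable hfi (x, y))]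
    congr 1
    ext x'
    rw [← integral_const_mul]
    congr 1
    ext y'
    simp only [PK]; ring
  rw [e]
  refine (enorm_integral_le_lintegral_enorm _).trans ?_
  rw [← lintegral_const_mul' _ _ ENNReal.ofReal_ne_top]
  gcongr with x'
  rw [enorm_mul]
  gcongr
  exact h1.enorm_le _ _

theorem mixed_sup (h1 : GoodKer μ A1 K1) (h2 : GoodKer ν A2 K2)
    (h : GoodKer (μ.prod ν) (A1 * A2) (PK K1 K2)) {s : ℝ} (hs : 2 ≤ s)
    (f : α × β → ℂ) (hf : Measurable f) (hfi : Integrable f (μ.prod ν)) (x : α) :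
    (∫⁻ y, ‖TK (μ.prod ν) (PK K1 K2) f (x, y)‖ₑ ^ s ∂ν) ^ (1 / s) ≤
      ENNReal.ofReal (A1 * (Cs s * A2 ^ (s - 2)) ^ (1 / s)) *
        ∫⁻ x', (∫⁻ y, ‖f (x', y)‖ₑ ^ (s / (s - 1)) ∂ν) ^ ((s - 1) / s) ∂μ := by
  have hs0 : 0 < s := by linarith
  have hA1 := h1.pos
  have hA2 := h2.pos
  have hC := Cs_pos hs
  set F : α → β → ℝ≥0∞ := fun x' y => ‖TK ν K2 (fun y' => f (x', y')) y‖ₑ with hF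
  have hFm : Measurable (Function.uncurry F) := by
    apply Measurable.enorm
    apply StronglyMeasurable.measurable
    apply MeasureTheory.StronglyMeasurable.integral_prod_right
      (f := fun (z : α × β) w => K2 z.2 w * f (z.1, w))
    apply Measurable.stronglyMeasurable
    apply Measurable.mul
    · exact h2.meas.comp (by fun_prop : Measurable fun q : (α × β) × β => (q.1.2, q.2))
    · exact hf.comp (by fun_prop : Measurable fun q : (α × β) × β => (q.1.1, q.2))
  have hfin : ∫⁻ y, (∫⁻ x, F x y ∂μ) ^ s ∂ν ≠ ∞ := by
    have hb : ∀ y, ∫⁻ x, F x y ∂μ ≤ ENNReal.ofReal A2 * ∫⁻ z, ‖f z‖ₑ ∂(μ.prod ν) := by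
      intro y
      rw [lintegral_prod _ hf.enorm.aemeasurable, ← lintegral_const_mul' _ _ ENNReal.ofReal_ne_top]
      gcongr with x
      exact h2.sup _ (hf.comp measurable_prodMk_left) y
    have ht : ENNReal.ofReal A2 * ∫⁻ z, ‖f z‖ₑ ∂(μ.prod ν) ≠ ∞ :=
      ENNReal.mul_ne_top ENNReal.ofReal_ne_top hfi.2.ne
    refine ne_top_of_le_ne_top (b := ∫⁻ y, (ENNReal.ofReal A2 * ∫⁻ z, ‖f z‖ₑ ∂(μ.prod ν)) ^ s ∂ν)
      ?_ (by gcongr with y; exact hb y)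
    rw [lintegral_const]
    exact ENNReal.mul_ne_top (ENNReal.rpow_ne_top_of_nonneg hs0.le ht) (measure_ne_top _ _)
  calc _ ≤ (∫⁻ y, (ENNReal.ofReal A1 * ∫⁻ x', F x' y ∂μ) ^ s ∂ν) ^ (1 / s) := by
        gcongr with y
        exact TK_prod h1 h f hfi x y
    _ = ENNReal.ofReal A1 * (∫⁻ y, (∫⁻ x', F x' y ∂μ) ^ s ∂ν) ^ (1 / s) := by
        simp only [ENNReal.mul_rpow_of_nonneg _ _ hs0.le]
        rw [lintegral_const_mul' _ _ (ENNReal.rpow_ne_top_of_nonneg hs0.le ENNReal.ofReal_ne_top),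
          ENNReal.mul_rpow_of_nonneg _ _ (by positivity), ← ENNReal.rpow_mul,
          mul_one_div_cancel hs0.ne', ENNReal.rpow_one]
    _ ≤ ENNReal.ofReal A1 * ∫⁻ x', (∫⁻ y, F x' y ^ s ∂ν) ^ (1 / s) ∂μ := by
        gcongr
        exact minkowski_int μ ν F hFm (by linarith) hfin
    _ ≤ ENNReal.ofReal A1 * ∫⁻ x', ENNReal.ofReal ((Cs s * A2 ^ (s - 2)) ^ (1 / s)) *
        (∫⁻ y, ‖f (x', y)‖ₑ ^ (s / (s - 1)) ∂ν) ^ ((s - 1) / s) ∂μ := by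
        gcongr ENNReal.ofReal A1 * ?_
        apply lintegral_mono_ae
        filter_upwards [hfi.prod_right_ae] with x' hx'
        have := h2.scalar hs (fun y' => f (x', y')) (hf.comp measurable_prodMk_left) hx'
        calc _ ≤ _ := ENNReal.rpow_le_rpow this (by positivity : 0 ≤ 1 / s)
          _ = _ := by
            rw [ENNReal.mul_rpow_of_nonneg _ _ (by positivity), ← ENNReal.rpow_mul,
              ENNReal.ofReal_rpow_of_pos (by positivity), mul_one_div]
    _ = _ := by
        rw [lintegral_const_mul' _ _ ENNReal.ofReal_ne_top, ← mul_assoc,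
          ENNReal.ofReal_mul hA1.le]

/-- constant in the mixed bound -/
def Cm (r s : ℝ) : ℝ :=
  if s = r then Cs s else r * 2 ^ r / ((r - s) / (s - 1)) * Cs s * (Cs s) ^ ((r - s) / s)

lemma Cm_pos {r s : ℝ} (hs : 2 ≤ s) (hr : s ≤ r) : 0 < Cm r s := by
  have := Cs_pos hs
  unfold Cm
  split_ifs with h
  · exact this
  · have h1 : 0 < r - s := by
      rcases hr.lt_or_eq with h1 | h1
      · linarith
      · exact absurd h1 h
    have : 0 < r := by linarith
    have : 0 < s - 1 := by linarith
    positivity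

theorem mixed_fin (h1 : GoodKer μ A1 K1) (h2 : GoodKer ν A2 K2)
    (h : GoodKer (μ.prod ν) (A1 * A2) (PK K1 K2)) {s r : ℝ} (hs : 2 ≤ s) (hsr : s ≤ r)
    (f : α × β → ℂ) (hf : Measurable f) (hfi : Integrable f (μ.prod ν)) :
    ∫⁻ x, ((∫⁻ y, ‖TK (μ.prod ν) (PK K1 K2) f (x, y)‖ₑ ^ s ∂ν) ^ (1 / s)) ^ r ∂μ ≤
      ENNReal.ofReal (Cm r s * (A1 ^ (r - 2) * A2 ^ ((s - 2) * r / s))) *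
        (∫⁻ x, ((∫⁻ y, ‖f (x, y)‖ₑ ^ (s / (s - 1)) ∂ν) ^ ((s - 1) / s)) ^ (r / (r - 1)) ∂μ) ^ (r - 1)
          := by
  have hs0 : 0 < s := by linarith
  have hs1 : 0 < s - 1 := by linarith
  have hA1 := h1.pos
  have hA2 := h2.pos
  have hC := Cs_pos hs
  have hTm := h.measT f hf
  -- the diagonal case, for all integrable measurable functions
  have diag : ∀ g : α × β → ℂ, Measurable g → Integrable g (μ.prod ν) →
      ∫⁻ x, ((∫⁻ y, ‖TK (μ.prod ν) (PK K1 K2) g (x, y)‖ₑ ^ s ∂ν) ^ (1 / s)) ^ s ∂μ ≤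
      ENNReal.ofReal (Cs s * (A1 * A2) ^ (s - 2)) *
        (∫⁻ x, ((∫⁻ y, ‖g (x, y)‖ₑ ^ (s / (s - 1)) ∂ν) ^ ((s - 1) / s)) ^ (s / (s - 1)) ∂μ) ^ (s - 1)
      := by
    intro g hg hgi
    have hTg := h.measT g hg
    have := h.scalar hs g hg hgi
    rw [lintegral_prod _ (hTg.enorm.pow_const _).aemeasurable,
      lintegral_prod _ (hg.enorm.pow_const _).aemeasurable] at this
    simp only [← ENNReal.rpow_mul]
    rw [show 1 / s * s = 1 by field_simp, show (s - 1) / s * (s / (s - 1)) = 1 by field_simp]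
    simpa only [ENNReal.rpow_one] using this
  rcases hsr.lt_or_eq with hlt | rfl
  swap
  · refine (diag f hf hfi).trans (le_of_eq ?_)
    congr 2
    rw [Cm, if_pos rfl, Real.mul_rpow hA1.le hA2.le]
    congr 3
    field_simp
  set φ : α → ℝ≥0∞ := fun x => (∫⁻ y, ‖f (x, y)‖ₑ ^ (s / (s - 1)) ∂ν) ^ ((s - 1) / s) with hφ
  have hφm : Measurable φ := ((hf.enorm.pow_const _).lintegral_prod_right').pow_const _
  have hss : 0 < s / (s - 1) := by positivity
  have hm := marcin μ (p := s) (r := r) (M0 := (Cs s * (A1 * A2) ^ (s - 2)) ^ (1 / s))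
      (M1 := A1 * (Cs s * A2 ^ (s - 2)) ^ (1 / s)) hs hlt (by positivity) (by positivity)
      φ (fun x => (∫⁻ y, ‖TK (μ.prod ν) (PK K1 K2) f (x, y)‖ₑ ^ s ∂ν) ^ (1 / s))
      hφm (((hTm.enorm.pow_const _).lintegral_prod_right').pow_const _)
      (by
        intro x
        apply ENNReal.rpow_ne_top_of_nonneg (by positivity)
        have ht : ENNReal.ofReal (A1 * A2) * ∫⁻ z, ‖f z‖ₑ ∂(μ.prod ν) ≠ ∞ :=
          ENNReal.mul_ne_top ENNReal.ofReal_ne_top hfi.2.ne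
        refine ne_top_of_le_ne_top
          (b := ∫⁻ y, (ENNReal.ofReal (A1 * A2) * ∫⁻ z, ‖f z‖ₑ ∂(μ.prod ν)) ^ s ∂ν)
          ?_ (by gcongr with y; exact h.sup f hf (x, y))
        rw [lintegral_const]
        exact ENNReal.mul_ne_top (ENNReal.rpow_ne_top_of_nonneg hs0.le ht) (measure_ne_top _ _))
      (by
        intro a ha
        set S : Set α := {x | φ x ≤ ENNReal.ofReal a} with hS
        have hSm : MeasurableSet S := measurableSet_le hφm measurable_const
        have hSc : Sᶜ = {x | ENNReal.ofReal a < φ x} := by ext x; simp [hS]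
        set S' : Set (α × β) := Prod.fst ⁻¹' S with hS'
        have hSm' : MeasurableSet S' := measurable_fst hSm
        have key : ∀ U : Set α, ∀ x, (∫⁻ y, ‖(Prod.fst ⁻¹' U).indicator f (x, y)‖ₑ ^ (s / (s - 1)) ∂ν)
            ^ ((s - 1) / s) = U.indicator φ x := by
          intro U x
          by_cases hx : x ∈ U
          · have : ∀ y, (Prod.fst ⁻¹' U).indicator f (x, y) = f (x, y) := fun y => by simp [hx]
            simp only [this, Set.indicator_of_mem hx, hφ]
          · have : ∀ y, (Prod.fst ⁻¹' U).indicator f (x, y) = 0 := fun y => by simp [hx]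
            simp only [this, Set.indicator_of_notMem hx, enorm_zero]
            rw [ENNReal.zero_rpow_of_pos hss, lintegral_zero, ENNReal.zero_rpow_of_pos]
            positivity
        refine ⟨fun x => (∫⁻ y, ‖TK (μ.prod ν) (PK K1 K2) (S'.indicator f) (x, y)‖ₑ ^ s ∂ν) ^ (1 / s),
          ((((h.measT _ (hf.indicator hSm')).enorm.pow_const _).lintegral_prod_right').pow_const _),
          Filter.Eventually.of_forall fun x => ?_, ?_⟩
        · simp only
          have hb := mixed_sup h1 h2 h hs _ (hf.indicator hSm'.compl) (hfi.indicator hSm'.compl) x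
          have hcompl : S'ᶜ = Prod.fst ⁻¹' Sᶜ := rfl
          rw [hcompl] at hb
          simp only [key] at hb
          rw [lintegral_indicator hSm.compl, hSc] at hb
          refine le_trans ?_ (add_le_add_right hb _)
          rw [← hSc, ← hcompl]
          refine le_trans ?_ (ENNReal.lintegral_Lp_add_le (μ := ν) (p := s) ?_ ?_ (by linarith))
          · gcongr with y
            rw [h.split hfi hSm' (x, y)]
            exact enorm_add_le _ _
          · exact (((h.measT _ (hf.indicator hSm')).enorm.comp measurable_prodMk_left)).aemeasurable
          · exact (((h.measT _ (hf.indicator hSm'.compl)).enorm.comp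
              measurable_prodMk_left)).aemeasurable
        · refine (diag _ (hf.indicator hSm') (hfi.indicator hSm')).trans (le_of_eq ?_)
          simp only [hS', key]
          rw [← Real.rpow_mul (by positivity), one_div_mul_cancel hs0.ne', Real.rpow_one,
            ← lintegral_indicator hSm]
          congr 3
          ext x
          by_cases hx : x ∈ S
          · simp [hx]
          · simp only [Set.indicator_of_notMem hx, ENNReal.zero_rpow_of_pos hss])
  refine hm.trans (le_of_eq ?_)
  congr 2
  have e1 : A1 ^ (r - 2) = A1 ^ (s - 2) * A1 ^ (r - s) := by
    rw [← Real.rpow_add hA1]; congr 1; ring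
  have e2 : A2 ^ ((s - 2) * r / s) = A2 ^ (s - 2) * A2 ^ ((s - 2) * ((r - s) / s)) := by
    rw [← Real.rpow_add hA2]; congr 1; field_simp; ring
  have e3 : ((Cs s * (A1 * A2) ^ (s - 2)) ^ (1 / s)) ^ s = Cs s * (A1 ^ (s - 2) * A2 ^ (s - 2)) := by
    rw [← Real.rpow_mul (by positivity), one_div_mul_cancel hs0.ne', Real.rpow_one,
      Real.mul_rpow hA1.le hA2.le]
  have e4 : (A1 * (Cs s * A2 ^ (s - 2)) ^ (1 / s)) ^ (r - s) =
      A1 ^ (r - s) * (Cs s ^ ((r - s) / s) * A2 ^ ((s - 2) * ((r - s) / s))) := by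
    rw [Real.mul_rpow hA1.le (by positivity), ← Real.rpow_mul (by positivity),
      one_div_mul_eq_div, Real.mul_rpow hC.le (by positivity), ← Real.rpow_mul hA2.le]
  rw [Cm, if_neg hlt.ne, e1, e2, e3, e4]
  ring

end prod

/-! ### `L²` bounds and torus kernels -/

theorem goodKer_of_ortho {α ι : Type*} [MeasurableSpace α] {μ : Measure α} [IsFiniteMeasure μ]
    [DecidableEq ι] (S : Finset ι) (e : ι → α → ℂ) (he : ∀ i, Measurable (e i))
    (hb : ∀ i z, ‖e i z‖ = 1)
    (ho : ∀ i j, ∫ z, e j z * conj (e i z) ∂μ = if i = j then 1 else 0)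
    (c : ι → ℂ) (hc : ∀ i, ‖c i‖ = 1) {A : ℝ} (hA : 0 < A) (K : α → α → ℂ)
    (hK : ∀ z w, K z w = ∑ i ∈ S, c i * (e i z * conj (e i w))) (hbd : ∀ z w, ‖K z w‖ ≤ A) :
    GoodKer μ A K where
  pos := hA
  bdd := hbd
  meas := by
    have : Function.uncurry K = fun q : α × α => ∑ i ∈ S, c i * (e i q.1 * conj (e i q.2)) := by
      ext q; exact hK q.1 q.2
    rw [this]
    apply Finset.measurable_sum
    intro i _
    apply Measurable.const_mul
    apply Measurable.mul
    · exact (he i).comp measurable_fst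
    · exact Complex.continuous_conj.measurable.comp ((he i).comp measurable_snd)
  l2 := by
    intro f hf hfi
    rcases eq_or_ne (∫⁻ z, ‖f z‖ₑ ^ (2 : ℝ) ∂μ) ∞ with ht | ht
    · rw [ht]; exact le_top
    have e2 : ∀ g : α → ℂ, ∫⁻ z, ‖g z‖ₑ ^ (2 : ℝ) ∂μ = eLpNorm g 2 μ ^ (2 : ℝ) := by
      intro g
      rw [eLpNorm_eq_lintegral_rpow_enorm_toReal (by norm_num) (by norm_num), ← ENNReal.rpow_mul]
      simp
    have hf2 : MemLp f 2 μ := by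
      refine ⟨hf.aestronglyMeasurable, ?_⟩
      rw [e2] at ht
      by_contra h
      rw [not_lt, top_le_iff] at h
      rw [h] at ht
      simp at ht
    have hei : ∀ i, MemLp (e i) 2 μ := fun i =>
      MemLp.of_bound (he i).aestronglyMeasurable 1 (Filter.Eventually.of_forall fun z => (hb i z).le)
    let v : ι → Lp ℂ 2 μ := fun i => (hei i).toLp (e i)
    have hin : ∀ (i : ι) (g : α → ℂ) (hg : MemLp g 2 μ),
        inner ℂ (v i) (hg.toLp g) = ∫ z, g z * conj (e i z) ∂μ := by
      intro i g hg
      rw [L2.inner_def]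
      apply integral_congr_ae
      filter_upwards [(hei i).coeFn_toLp, hg.coeFn_toLp] with z h1 h2
      simp only [v]
      rw [h1, h2, RCLike.inner_apply]
    have hv : Orthonormal ℂ v := by
      rw [orthonormal_iff_ite]
      intro i j
      rw [hin i (e j) (hei j), ho]
    let a : ι → ℂ := fun i => ∫ z, f z * conj (e i z) ∂μ
    have hTK : ∀ z, TK μ K f z = ∑ i ∈ S, (c i * a i) * e i z := by
      intro z
      unfold TK
      have : ∀ w, K z w * f w = ∑ i ∈ S, (c i * e i z) * (f w * conj (e i w)) := by
        intro w
        rw [hK, sum_mul]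
        apply sum_congr rfl
        intro i _; ring
      simp only [this]
      rw [integral_finsetSum]
      · apply sum_congr rfl
        intro i _
        rw [integral_const_mul]
        simp only [a]; ring
      · intro i _
        apply Integrable.const_mul
        apply hfi.mul_bdd (c := 1)
        · exact (Complex.continuous_conj.measurable.comp (he i)).aestronglyMeasurable
        · exact Filter.Eventually.of_forall fun z => by simp [hb i z]
    set F := hf2.toLp f
    set V : Lp ℂ 2 μ := ∑ i ∈ S, (c i * a i) • v i with hV
    have hVF : ‖V‖ ^ 2 ≤ ‖F‖ ^ 2 := by
      have h1 : ‖V‖ ^ 2 = ∑ i ∈ S, ‖inner ℂ (v i) F‖ ^ 2 := by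
        have h2 := hv.inner_sum (fun i => c i * a i) (fun i => c i * a i) S
        rw [← hV, inner_self_eq_norm_sq_to_K] at h2
        have h3 : ∀ i, conj (c i * a i) * (c i * a i) = ((‖inner ℂ (v i) F‖ ^ 2 : ℝ) : ℂ) := by
          intro i
          rw [Complex.conj_mul', norm_mul, hc, one_mul, hin i f hf2]
          push_cast; rfl
        simp only [h3] at h2
        rw [← Complex.ofReal_sum] at h2
        have h4 := congrArg Complex.re h2
        rw [Complex.ofReal_re] at h4
        rw [← h4]
        norm_cast
      rw [h1]
      exact hv.sum_inner_products_le F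
    have hVn : ‖V‖ ≤ ‖F‖ := by
      exact le_of_sq_le_sq hVF (norm_nonneg _) 
    have hVT : eLpNorm (TK μ K f) 2 μ = ENNReal.ofReal ‖V‖ := by
      rw [Lp.norm_def, ENNReal.ofReal_toReal (Lp.eLpNorm_ne_top V)]
      apply eLpNorm_congr_ae
      have hco : (V : α → ℂ) =ᵐ[μ] fun z => ∑ i ∈ S, ((c i * a i) • v i : Lp ℂ 2 μ) z := by
        rw [hV]
        filter_upwards [Lp.coeFn_finsetSum S (fun i => ((c i * a i) • v i : Lp ℂ 2 μ))] with z hz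
        rw [hz, Finset.sum_apply]
      have hall : ∀ᵐ z ∂μ, ∀ i ∈ S, ((c i * a i) • v i : Lp ℂ 2 μ) z = (c i * a i) * e i z := by
        rw [Finset.eventually_all]
        intro i _
        filter_upwards [Lp.coeFn_smul (c i * a i) (v i), (hei i).coeFn_toLp] with z h1 h2
        rw [h1, Pi.smul_apply, smul_eq_mul, h2]
      filter_upwards [hco, hall] with z h1 h2
      rw [h1, hTK]
      exact (sum_congr rfl h2).symm
    rw [e2, e2, hVT]
    have hFf : eLpNorm f 2 μ = ENNReal.ofReal ‖F‖ := by
      rw [Lp.norm_toLp, ENNReal.ofReal_toReal hf2.2.ne]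
    rw [hFf]
    gcongr

lemma fourier_ortho (n m : ℤ) :
    ∫ x : AddCircle (1 : ℝ), fourier n x * conj (fourier m x) = if m = n then 1 else 0 := by
  have h := congrFun (fourierCoeff_fourier (T := 1) n) m
  rw [fourierCoeff, AddCircle.integral_haarAddCircle] at h
  simp only [inv_one, one_smul, smul_eq_mul] at h
  rw [Pi.single_apply] at h
  rw [← h]
  congr 1
  ext x
  rw [fourier_neg, mul_comm]

lemma fourier_abs (n : ℤ) (x : AddCircle (1 : ℝ)) : ‖fourier n x‖ = 1 := by
  rw [fourier_apply]; exact Circle.norm_coe _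

lemma eChar_norm {m : ℕ} (ξ : Fin m → ℤ) (z : Torus m) : ‖eChar ξ z‖ = 1 := by
  rw [eChar, norm_prod]
  exact prod_eq_one (fun i _ => fourier_abs _ _)

lemma eChar_meas {m : ℕ} (ξ : Fin m → ℤ) : Measurable (eChar ξ) := by
  apply Continuous.measurable
  unfold eChar
  fun_prop

lemma eChar_ortho {m : ℕ} (ξ η : Fin m → ℤ) :
    ∫ z : Torus m, eChar η z * conj (eChar ξ z) = if ξ = η then 1 else 0 := by
  simp only [eChar, map_prod, ← prod_mul_distrib]
  rw [integral_fintype_prod_volume_eq_prod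
    (fun i (x : AddCircle (1 : ℝ)) => fourier (η i) x * conj (fourier (ξ i) x))]
  simp only [fourier_ortho]
  rw [Finset.prod_ite_zero]
  simp [funext_iff]

/-- phase -/
def ph {m : ℕ} (t : ℝ) (ξ : Fin m → ℤ) : ℂ := ee (t * ∑ i, (ξ i : ℝ) ^ 2)

/-- The torus kernel. -/
def Km (m N : ℕ) (t : ℝ) (z w : Torus m) : ℂ :=
  ∑ ξ ∈ box m N, ph t ξ * (eChar ξ z * conj (eChar ξ w))

lemma kernel_circle (N : ℕ) (hN : 1 ≤ N) (t : ℝ) (ht : t ≠ 0) (htN : |t| ≤ 1 / (2 * N))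
    (x y : AddCircle (1 : ℝ)) :
    ‖∑ n ∈ Finset.Icc (-(N : ℤ)) N, ee (t * (n : ℝ) ^ 2) * (fourier n x * conj (fourier n y))‖ ≤
      500 / √|t| := by
  obtain ⟨a, rfl⟩ := QuotientAddGroup.mk_surjective x
  obtain ⟨b, rfl⟩ := QuotientAddGroup.mk_surjective y
  refine le_trans (le_of_eq ?_) (kernel_real N hN t ht htN (a - b))
  congr 1
  apply sum_congr rfl
  intro n _
  rw [ee_add]
  congr 1
  rw [← fourier_neg]
  rw [fourier_coe_apply, fourier_coe_apply, ← Complex.exp_add, ee]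
  congr 1
  push_cast
  ring

lemma Km_bound (m N : ℕ) (hN : 1 ≤ N) (t : ℝ) (ht : t ≠ 0) (htN : |t| ≤ 1 / (2 * N))
    (z w : Torus m) : ‖Km m N t z w‖ ≤ (500 / √|t|) ^ m := by
  have e : Km m N t z w = ∏ i : Fin m, ∑ n ∈ Finset.Icc (-(N : ℤ)) N,
      ee (t * (n : ℝ) ^ 2) * (fourier n (z i) * conj (fourier n (w i))) := by
    rw [prod_univ_sum, Km]
    have hbox : _root_.box m N = Fintype.piFinset fun _ => Finset.Icc (-(N : ℤ)) N := by
      unfold _root_.box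
      exact Pi.Icc_eq _ _
    rw [hbox]
    apply sum_congr rfl
    intro ξ _
    rw [prod_mul_distrib, prod_mul_distrib, eChar, eChar, map_prod]
    congr 1
    simp only [ph, ee]
    rw [← Complex.exp_sum]
    congr 1
    push_cast
    rw [← mul_sum, ← mul_sum]
  rw [e, norm_prod]
  calc _ ≤ ∏ i : Fin m, (500 / √|t|) := by
        apply prod_le_prod
        · intros; positivity
        · intro i _; exact kernel_circle N hN t ht htN _ _
    _ = _ := by rw [prod_const, card_univ, Fintype.card_fin]

lemma Km_good (m N : ℕ) (hN : 1 ≤ N) (t : ℝ) (ht : t ≠ 0) (htN : |t| ≤ 1 / (2 * N)) :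
    GoodKer (volume : Measure (Torus m)) ((500 / √|t|) ^ m) (Km m N t) :=
  goodKer_of_ortho (box m N) eChar eChar_meas eChar_norm eChar_ortho (ph t) (fun _ => ee_norm _)
    (by have := abs_pos.2 ht; positivity) _ (fun _ _ => rfl) (Km_bound m N hN t ht htN)

lemma eChar2_ortho {m k : ℕ} (ξ η : (Fin m → ℤ) × (Fin k → ℤ)) :
    ∫ z : Torus m × Torus k, eChar η.1 z.1 * eChar η.2 z.2 * conj (eChar ξ.1 z.1 * eChar ξ.2 z.2)
      ∂((volume : Measure (Torus m)).prod (volume : Measure (Torus k))) =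
      if ξ = η then 1 else 0 := by
  have : ∀ z : Torus m × Torus k, eChar η.1 z.1 * eChar η.2 z.2 *
      conj (eChar ξ.1 z.1 * eChar ξ.2 z.2) =
      (eChar η.1 z.1 * conj (eChar ξ.1 z.1)) * (eChar η.2 z.2 * conj (eChar ξ.2 z.2)) := by
    intro z; rw [map_mul]; ring
  simp only [this]
  rw [integral_prod_mul (fun x => eChar η.1 x * conj (eChar ξ.1 x))
    (fun y => eChar η.2 y * conj (eChar ξ.2 y)), eChar_ortho, eChar_ortho]
  by_cases h1 : ξ.1 = η.1 <;> by_cases h2 : ξ.2 = η.2 <;> simp [h1, h2, Prod.ext_iff]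

lemma PK_sum (m k N : ℕ) (t : ℝ) (z w : Torus m × Torus k) :
    PK (Km m N t) (Km k N t) z w = ∑ ξ ∈ _root_.box m N ×ˢ _root_.box k N,
      (ph t ξ.1 * ph t ξ.2) * ((eChar ξ.1 z.1 * eChar ξ.2 z.2) *
        conj (eChar ξ.1 w.1 * eChar ξ.2 w.2)) := by
  rw [PK, Km, Km, sum_mul_sum, sum_product]
  apply sum_congr rfl; intro a _
  apply sum_congr rfl; intro b _
  simp only [map_mul]; ring

lemma PK_bound (m k N : ℕ) (hN : 1 ≤ N) (t : ℝ) (ht : t ≠ 0) (htN : |t| ≤ 1 / (2 * N))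
    (z w : Torus m × Torus k) :
    ‖PK (Km m N t) (Km k N t) z w‖ ≤ (500 / √|t|) ^ m * (500 / √|t|) ^ k := by
  rw [PK, norm_mul]
  exact mul_le_mul (Km_bound m N hN t ht htN _ _) (Km_bound k N hN t ht htN _ _)
    (norm_nonneg _) (by positivity)

lemma PK_good (m k N : ℕ) (hN : 1 ≤ N) (t : ℝ) (ht : t ≠ 0) (htN : |t| ≤ 1 / (2 * N)) :
    GoodKer ((volume : Measure (Torus m)).prod (volume : Measure (Torus k)))
      ((500 / √|t|) ^ m * (500 / √|t|) ^ k) (PK (Km m N t) (Km k N t)) := by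
  have hpos := abs_pos.2 ht
  have hA : 0 < (500 / √|t|) ^ m * (500 / √|t|) ^ k := by positivity
  have hm : ∀ ξ : (Fin m → ℤ) × (Fin k → ℤ), Measurable
      (fun z : Torus m × Torus k => eChar ξ.1 z.1 * eChar ξ.2 z.2) :=
    fun ξ => ((eChar_meas _).comp measurable_fst).mul ((eChar_meas _).comp measurable_snd)
  have hn : ∀ (ξ : (Fin m → ℤ) × (Fin k → ℤ)) (z : Torus m × Torus k),
      ‖eChar ξ.1 z.1 * eChar ξ.2 z.2‖ = 1 :=
    fun ξ z => by rw [norm_mul, eChar_norm, eChar_norm, one_mul]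
  have hc : ∀ ξ : (Fin m → ℤ) × (Fin k → ℤ), ‖ph t ξ.1 * ph t ξ.2‖ = 1 :=
    fun ξ => by rw [norm_mul, ph, ph, ee_norm, ee_norm, one_mul]
  exact goodKer_of_ortho (_root_.box m N ×ˢ _root_.box k N)
    (fun (ξ : (Fin m → ℤ) × (Fin k → ℤ)) (z : Torus m × Torus k) => eChar ξ.1 z.1 * eChar ξ.2 z.2)
    hm hn eChar2_ortho (fun ξ => ph t ξ.1 * ph t ξ.2) hc hA _ (PK_sum m k N t)
    (PK_bound m k N hN t ht htN)

lemma prp_eq (m k N : ℕ) (t : ℝ) (f : Torus m × Torus k → ℂ)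
    (hf : Integrable f) (z : Torus m × Torus k) :
    prp N t f z = TK ((volume : Measure (Torus m)).prod (volume : Measure (Torus k)))
      (PK (Km m N t) (Km k N t)) f z := by
  unfold TK
  have : ∀ w, PK (Km m N t) (Km k N t) z w * f w = ∑ a ∈ box m N, ∑ b ∈ box k N,
      (ph t a * ph t b * (eChar a z.1 * eChar b z.2)) *
        (f w * conj (eChar a w.1 * eChar b w.2)) := by
    intro w
    rw [PK, Km, Km, sum_mul_sum, sum_mul]
    apply sum_congr rfl; intro a _
    rw [sum_mul]
    apply sum_congr rfl; intro b _
    simp only [map_mul]; ring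
  simp only [this]
  have hi : ∀ a b, Integrable (fun w : Torus m × Torus k => f w * conj (eChar a w.1 * eChar b w.2))
      ((volume : Measure (Torus m)).prod (volume : Measure (Torus k))) := by
    intro a b
    apply Integrable.mul_bdd (c := 1) hf
    · apply Measurable.aestronglyMeasurable
      exact Complex.continuous_conj.measurable.comp
        (((eChar_meas _).comp measurable_fst).mul ((eChar_meas _).comp measurable_snd))
    · exact Filter.Eventually.of_forall fun z => by
        rw [RCLike.norm_conj, norm_mul, eChar_norm, eChar_norm, one_mul]
  rw [integral_finsetSum _ (fun a _ => integrable_finsetSum _ (fun b _ => (hi a b).const_mul _)), prp]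
  apply sum_congr rfl; intro a _
  rw [integral_finsetSum _ (fun b _ => (hi a b).const_mul _)]
  apply sum_congr rfl; intro b _
  rw [integral_const_mul]
  change fcoef f (a, b) * _ * _ = _ * fcoef f (a, b)
  have e : Complex.exp (2 * Real.pi * I * t * ((∑ i, (a i : ℝ) ^ 2) + ∑ i, (b i : ℝ) ^ 2)) =
      ph t a * ph t b := by
    rw [ph, ph, ee, ee, ← Complex.exp_add]
    congr 1
    push_cast
    ring
  rw [← e]
  push_cast
  ring

lemma prp_zero (m k N : ℕ) (t : ℝ) (f : Torus m × Torus k → ℂ)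
    (hf : ¬ Integrable f) : prp N t f = 0 := by
  have h0 : ∀ ξ, fcoef f ξ = 0 := by
    intro ξ
    apply integral_undef
    intro hi
    apply hf
    have : f = fun z => (f z * conj (eChar ξ.1 z.1 * eChar ξ.2 z.2)) *
        (eChar ξ.1 z.1 * eChar ξ.2 z.2) := by
      ext z
      rw [mul_assoc, Complex.conj_mul', norm_mul, eChar_norm, eChar_norm]
      simp
    rw [this]
    apply Integrable.mul_bdd (c := 1) hi
    · apply Measurable.aestronglyMeasurable
      exact (((eChar_meas _).comp measurable_fst).mul ((eChar_meas _).comp measurable_snd))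
    · exact Filter.Eventually.of_forall fun z => by
        rw [norm_mul, eChar_norm, eChar_norm, one_mul]
  ext z
  simp [prp, h0]

/-! ### Final assembly -/

lemma conj_fin {r r' : ℝ≥0∞} (h2 : 2 ≤ r) (hr : r ≠ ∞) (h : 1 / r + 1 / r' = 1) :
    r' ≠ ∞ ∧ r'.toReal = r.toReal / (r.toReal - 1) := by
  have hR2 : (2 : ℝ) ≤ r.toReal := by
    have := (ENNReal.toReal_le_toReal (by norm_num) hr).2 h2
    simpa using this
  have h1 : 1 / r ≠ ∞ := by
    intro h'; rw [h'] at h; simp at h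
  have h1' : 1 / r' ≠ ∞ := by
    intro h'; rw [h'] at h; simp at h
  have e := congrArg ENNReal.toReal h
  rw [ENNReal.toReal_add h1 h1', ENNReal.toReal_div, ENNReal.toReal_div, ENNReal.toReal_one] at e
  have hne : r'.toReal ≠ 0 := by
    intro h'
    rw [h', div_zero, add_zero, div_eq_one_iff_eq (by linarith)] at e
    linarith
  refine ⟨?_, ?_⟩
  · rintro rfl; simp at hne
  · have : r.toReal - 1 ≠ 0 := by linarith
    have : r.toReal ≠ 0 := by linarith
    field_simp at e ⊢
    linarith

lemma conj_top {r' : ℝ≥0∞} (h : 1 / (∞ : ℝ≥0∞) + 1 / r' = 1) : r' = 1 := by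
  simpa using h

lemma eNorm_congr {α : Type*} [MeasurableSpace α] (p : ℝ≥0∞) {μ : Measure α} {g h : α → ℝ≥0∞}
    (e : g =ᵐ[μ] h) : eNorm p μ g = eNorm p μ h := by
  unfold eNorm
  split_ifs
  · exact essSup_congr_ae e
  · congr 1
    apply lintegral_congr_ae
    filter_upwards [e] with x hx
    rw [hx]

lemma mixedNorm_congr {m k : ℕ} (r s : ℝ≥0∞) {f g : Torus m × Torus k → ℂ}
    (e : f =ᵐ[(volume : Measure (Torus m)).prod (volume : Measure (Torus k))] g) :
    mixedNorm r s f = mixedNorm r s g := by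
  unfold mixedNorm
  apply eNorm_congr
  filter_upwards [Measure.ae_ae_of_ae_prod e] with x hx
  apply eNorm_congr
  filter_upwards [hx] with y hy
  rw [hy]

lemma prp_congr {m k : ℕ} (N : ℕ) (t : ℝ) {f g : Torus m × Torus k → ℂ}
    (e : f =ᵐ[(volume : Measure (Torus m)).prod (volume : Measure (Torus k))] g) :
    prp N t f = prp N t g := by
  have h : ∀ ξ, fcoef f ξ = fcoef g ξ := by
    intro ξ
    unfold fcoef
    apply integral_congr_ae
    have e' : f =ᵐ[(volume : Measure (Torus m × Torus k))] g := e
    filter_upwards [e'] with z hz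
    rw [hz]
  ext z
  simp only [prp, h]

lemma eNorm_zero {α : Type*} [MeasurableSpace α] {p : ℝ≥0∞} (hp : p ≠ 0) {μ : Measure α} :
    eNorm p μ (fun _ => 0) = 0 := by
  unfold eNorm
  split_ifs with h
  · exact essSup_const_bot
  · have : 0 < p.toReal := ENNReal.toReal_pos hp h
    simp [ENNReal.zero_rpow_of_pos this, this]

lemma mixedNorm_zero {m k : ℕ} {r s : ℝ≥0∞} (hr : r ≠ 0) (hs : s ≠ 0) :
    mixedNorm r s (0 : Torus m × Torus k → ℂ) = 0 := by
  unfold mixedNorm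
  simp only [Pi.zero_apply, nnnorm_zero, ENNReal.coe_zero, eNorm_zero hs, eNorm_zero hr]

lemma power_id (m k : ℕ) {t : ℝ} (ht : t ≠ 0) (p q : ℝ) :
    ((500 / √|t|) ^ m) ^ (1 - 2 * p) * ((500 / √|t|) ^ k) ^ (1 - 2 * q) =
      (500 : ℝ) ^ (2 * ((m : ℝ) * (1 / 2 - p) + k * (1 / 2 - q))) *
        |t| ^ (-((m : ℝ) * (1 / 2 - p) + k * (1 / 2 - q))) := by
  have hpos := abs_pos.2 ht
  have ha : 0 < 500 / √|t| := by positivity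
  rw [← Real.rpow_natCast, ← Real.rpow_natCast, ← Real.rpow_mul ha.le, ← Real.rpow_mul ha.le,
    ← Real.rpow_add ha, Real.div_rpow (by norm_num) (by positivity), Real.rpow_neg hpos.le,
    Real.sqrt_eq_rpow, ← Real.rpow_mul hpos.le, div_eq_mul_inv]
  congr 2
  · ring
  · congr 1; ring

/-- The estimate for measurable integrable functions. -/
lemma core (m k : ℕ) (r rt r' rt' : ℝ≥0∞) (hrt2 : 2 ≤ rt) (hrtr : rt ≤ r)
    (hr' : 1 / r + 1 / r' = 1) (hrt' : 1 / rt + 1 / rt' = 1) :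
    ∃ C : ℝ, 0 < C ∧ ∀ N : ℕ, 1 ≤ N → ∀ t : ℝ, t ≠ 0 → |t| ≤ 1 / (2 * N) →
      ∀ f : Torus m × Torus k → ℂ, Measurable f →
        Integrable f ((volume : Measure (Torus m)).prod (volume : Measure (Torus k))) →
        mixedNorm r rt (TK ((volume : Measure (Torus m)).prod (volume : Measure (Torus k)))
          (PK (Km m N t) (Km k N t)) f) ≤
          ENNReal.ofReal (C * (((500 / √|t|) ^ m) ^ (1 - 2 * (1 / r).toReal) *
            ((500 / √|t|) ^ k) ^ (1 - 2 * (1 / rt).toReal))) * mixedNorm r' rt' f := by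
  by_cases hr : r = ∞
  · subst hr
    obtain rfl := conj_top hr'
    by_cases hs : rt = ∞
    · subst hs
      obtain rfl := conj_top hrt'
      refine ⟨1, one_pos, ?_⟩
      intro N hN t ht htN f hf hfi
      have h := PK_good m k N hN t ht htN
      have e1 : mixedNorm 1 1 f = ∫⁻ z, ‖f z‖ₑ
          ∂((volume : Measure (Torus m)).prod (volume : Measure (Torus k))) := by
        rw [lintegral_prod _ hf.enorm.aemeasurable]
        simp [mixedNorm, eNorm, enorm_eq_nnnorm]
      rw [e1]
      simp only [mixedNorm, eNorm, if_true, ENNReal.div_top, ENNReal.toReal_zero, mul_zero,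
        sub_zero, Real.rpow_one, one_mul]
      refine essSup_le_of_ae_le _ (Filter.Eventually.of_forall fun x => ?_)
      refine essSup_le_of_ae_le _ (Filter.Eventually.of_forall fun y => ?_)
      exact h.sup f hf (x, y)
    · obtain ⟨hs1, hs2⟩ := conj_fin hrt2 hs hrt'
      have hS2 : (2 : ℝ) ≤ rt.toReal := by
        have := (ENNReal.toReal_le_toReal (by norm_num) hs).2 hrt2
        simpa using this
      set s := rt.toReal with hsdef
      refine ⟨Cs s ^ (1 / s), Real.rpow_pos_of_pos (Cs_pos hS2) _, ?_⟩
      intro N hN t ht htN f hf hfi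
      have h := PK_good m k N hN t ht htN
      have h1 := Km_good m N hN t ht htN
      have h2 := Km_good k N hN t ht htN
      have ev : 1 / (s / (s - 1)) = (s - 1) / s := one_div_div _ _
      simp only [mixedNorm, eNorm, if_true, if_neg hs, if_neg hs1, ← hsdef, hs2, ev,
        ENNReal.one_ne_top, if_false, ENNReal.toReal_one, ENNReal.rpow_one, div_one]
      refine essSup_le_of_ae_le _ (Filter.Eventually.of_forall fun x => ?_)
      refine (mixed_sup h1 h2 h hS2 f hf hfi x).trans (le_of_eq ?_)
      congr 2
      have hA2 := h2.pos
      rw [Real.mul_rpow (Cs_pos hS2).le (by positivity), ← Real.rpow_mul hA2.le]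
      simp only [ENNReal.div_top, ENNReal.toReal_zero, mul_zero, sub_zero, Real.rpow_one,
        ENNReal.toReal_div, ENNReal.toReal_one, ← hsdef]
      have : (s - 2) * (1 / s) = 1 - 2 * (1 / s) := by
        have : s ≠ 0 := by linarith
        field_simp
      rw [this]; ring
  · have hs : rt ≠ ∞ := fun h => hr (top_le_iff.1 (h ▸ hrtr))
    obtain ⟨hs1, hs2⟩ := conj_fin hrt2 hs hrt'
    obtain ⟨hr1, hr2⟩ := conj_fin (hrt2.trans hrtr) hr hr'
    have hS2 : (2 : ℝ) ≤ rt.toReal := by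
      have := (ENNReal.toReal_le_toReal (by norm_num) hs).2 hrt2
      simpa using this
    have hSR : rt.toReal ≤ r.toReal := (ENNReal.toReal_le_toReal hs hr).2 hrtr
    set s := rt.toReal with hsdef
    set R := r.toReal with hRdef
    have hs0 : s ≠ 0 := by linarith
    have hR0 : R ≠ 0 := by linarith
    refine ⟨Cm R s ^ (1 / R), Real.rpow_pos_of_pos (Cm_pos hS2 hSR) _, ?_⟩
    intro N hN t ht htN f hf hfi
    have h := PK_good m k N hN t ht htN
    have h1 := Km_good m N hN t ht htN
    have h2 := Km_good k N hN t ht htN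
    have ev : 1 / (s / (s - 1)) = (s - 1) / s := one_div_div _ _
    have ev' : 1 / (R / (R - 1)) = (R - 1) / R := one_div_div _ _
    simp only [mixedNorm, eNorm, if_neg hr, if_neg hr1, if_neg hs, if_neg hs1, ← hsdef, ← hRdef,
      hs2, hr2, ev, ev']
    have hA1 := h1.pos
    have hA2 := h2.pos
    have hC := Cm_pos hS2 hSR
    have key := ENNReal.rpow_le_rpow (mixed_fin h1 h2 h hS2 hSR f hf hfi)
      (show 0 ≤ 1 / R by positivity)
    refine key.trans (le_of_eq ?_)
    rw [ENNReal.mul_rpow_of_nonneg _ _ (by positivity), ← ENNReal.rpow_mul,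
      ENNReal.ofReal_rpow_of_nonneg (by positivity) (by positivity)]
    have e3 : (R - 1) * (1 / R) = (R - 1) / R := by ring
    rw [e3]
    congr 2
    rw [Real.mul_rpow hC.le (by positivity), Real.mul_rpow (by positivity) (by positivity),
      ← Real.rpow_mul hA1.le, ← Real.rpow_mul hA2.le]
    simp only [ENNReal.toReal_div, ENNReal.toReal_one, ← hsdef, ← hRdef]
    have e1 : (R - 2) * (1 / R) = 1 - 2 * (1 / R) := by field_simp
    have e2 : (s - 2) * R / s * (1 / R) = 1 - 2 * (1 / s) := by field_simp
    rw [e1, e2]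


/-- Fixed-time dispersive decay in mixed Lebesgue norms on the torus:
for `d ≥ 2`, `1 ≤ k ≤ d`, `2 ≤ r̃ ≤ r ≤ ∞` (with conjugate exponents `r'`, `r̃'`)
and `β(r,r̃) = (d-k)(1/2 - 1/r) + k(1/2 - 1/r̃)`, there is `C > 0` independent of
`N`, `t`, `f` such that for all `N ≥ 1` and `0 < |t| ≤ 1/(2N)`,
`‖e^{-itΔ}P_{≤N} f‖_{L^r_x L^r̃_y} ≤ C |t|^{-β(r,r̃)} ‖f‖_{L^{r'}_x L^{r̃'}_y}`. -/
theorem fixed_time_decay (d k : ℕ) (hd : 2 ≤ d) (hk1 : 1 ≤ k) (hkd : k ≤ d)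
    (r rt r' rt' : ℝ≥0∞) (hrt2 : 2 ≤ rt) (hrtr : rt ≤ r)
    (hr' : 1 / r + 1 / r' = 1) (hrt' : 1 / rt + 1 / rt' = 1) :
    ∃ C : ℝ, 0 < C ∧ ∀ N : ℕ, 1 ≤ N → ∀ t : ℝ, t ≠ 0 → |t| ≤ 1 / (2 * N) →
      ∀ f : Torus (d - k) × Torus k → ℂ,
        mixedNorm r rt (prp N t f) ≤
          ENNReal.ofReal
              (C * |t| ^
                (-(((d : ℝ) - k) * (1 / 2 - (1 / r).toReal) +
                    (k : ℝ) * (1 / 2 - (1 / rt).toReal)))) *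
            mixedNorm r' rt' f := by
  obtain ⟨C, hC, hcore⟩ := core (d - k) k r rt r' rt' hrt2 hrtr hr' hrt'
  have hcast : ((d - k : ℕ) : ℝ) = (d : ℝ) - k := Nat.cast_sub hkd
  refine ⟨C * (500 : ℝ) ^ (2 * (((d : ℝ) - k) * (1 / 2 - (1 / r).toReal) +
    (k : ℝ) * (1 / 2 - (1 / rt).toReal))), by positivity, ?_⟩
  intro N hN t ht htN f
  by_cases hfi : Integrable f
  · have hfi' : Integrable f ((volume : Measure (Torus (d - k))).prod
      (volume : Measure (Torus k))) := hfi
    have hg := hfi'.aestronglyMeasurable.ae_eq_mk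
    have hgm := hfi'.aestronglyMeasurable.stronglyMeasurable_mk.measurable
    set g := hfi'.aestronglyMeasurable.mk f
    have hgi := hfi'.congr hg
    rw [mixedNorm_congr r' rt' hg, prp_congr N t hg]
    have e : prp N t g = TK ((volume : Measure (Torus (d - k))).prod (volume : Measure (Torus k)))
        (PK (Km (d - k) N t) (Km k N t)) g := by
      ext z
      exact prp_eq (d - k) k N t g hgi z
    rw [e]
    refine (hcore N hN t ht htN g hgm hgi).trans (le_of_eq ?_)
    rw [power_id (d - k) k ht, hcast, mul_assoc C]
  · rw [prp_zero (d - k) k N t f hfi, mixedNorm_zero]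
    · exact bot_le
    · rintro rfl
      exact absurd (hrt2.trans hrtr) (by norm_num)
    · rintro rfl
      exact absurd hrt2 (by norm_num)

end
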